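/- arXiv:math/0510016 — 3 statements merged into one kernel-verified Lean document; each statement's English description precedes it below -/
import Mathlib

section
/- (Interior estimate for anisotropic mean curvature flow.) Let n > 1 and let F be an anisotropic area integrand that satisfies both the smallness-of-third-derivatives condition with a constant C₁ > 0 such that C₁² < 2/√n, and the symmetry condition. Let T > 0, M > 0, R > 0, and let u : ℝⁿ × [0,T] → ℝ be a C³ solution of the anisotropic mean curvature flow for graphs with |u(x,t)| ≤ M for all (x,t). Then there exist constants A > 0, P > 0, k > 0 and r > 1 depending only on F, a time T' > 0 depending on F and M, and a constant q > 1 depending on F, M and R, such that for all t with 0 < t ≤ min(T',T) and all x ∈ ℝⁿ with |x|² < R² − 2kt: F(Du(x,t) − φ⁰) ≤ max{ t^(q/2) · exp( A·q·(|u(x,t)| − 2M)² / (4t) ) · (R² − 2kt − |x|²)^(−r), P }. -/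
open Real Filter Set

/-- First derivative of `F` at `ν` applied to `v`. -/
noncomputable def D1 {E : Type*} [NormedAddCommGroup E] [NormedSpace ℝ E]
    (F : E → ℝ) (ν v : E) : ℝ :=
  fderiv ℝ F ν v

/-- Second derivative of `F` at `ν` as a bilinear form. -/
noncomputable def D2 {E : Type*} [NormedAddCommGroup E] [NormedSpace ℝ E]
    (F : E → ℝ) (ν v w : E) : ℝ :=
  iteratedFDeriv ℝ 2 F ν ![v, w]

/-- Third derivative of `F` at `ν` as a trilinear form. -/
noncomputable def D3 {E : Type*} [NormedAddCommGroup E] [NormedSpace ℝ E]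
    (F : E → ℝ) (ν v w z : E) : ℝ :=
  iteratedFDeriv ℝ 3 F ν ![v, w, z]

/-- `F : ℝ^(n+1) → ℝ` is an anisotropic area integrand: positive away from `0`,
convex, `C³` away from `0`, positively homogeneous of degree one, and with
uniformly convex sublevel sets (encoded via positivity of the second derivative
in non-radial directions). -/
def IsAreaIntegrand {n : ℕ} (F : (Fin (n + 1) → ℝ) → ℝ) : Prop :=
  (∀ v : Fin (n + 1) → ℝ, v ≠ 0 → 0 < F v) ∧
  ConvexOn ℝ Set.univ F ∧
  ContDiffOn ℝ 3 F {(0 : Fin (n + 1) → ℝ)}ᶜ ∧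
  (∀ (c : ℝ) (v : Fin (n + 1) → ℝ), 0 < c → F (c • v) = c * F v) ∧
  (∀ ν w : Fin (n + 1) → ℝ, ν ≠ 0 → (∀ c : ℝ, w ≠ c • ν) → 0 < D2 F ν w w)

/-- The symmetry condition: `F(p + φ⁰) = F(p − φ⁰)` for `p` in the span of
`φ¹, …, φⁿ` (i.e. with vanishing `0`-th coordinate). -/
def SymmCond {n : ℕ} (F : (Fin (n + 1) → ℝ) → ℝ) : Prop :=
  ∀ p : Fin (n + 1) → ℝ, p 0 = 0 →
    F (p + Pi.single 0 1) = F (p - Pi.single 0 1)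

/-- Smallness-of-third-derivatives condition with constant `C₁`, for directions
tangent to the level set of `F` at `ν`. -/
def SmallThird {n : ℕ} (F : (Fin (n + 1) → ℝ) → ℝ) (C₁ : ℝ) : Prop :=
  ∀ ν p q r : Fin (n + 1) → ℝ, ν ≠ 0 →
    D1 F ν p = 0 → D1 F ν q = 0 → D1 F ν r = 0 →
    F ν ^ 2 * D3 F ν p q r ≤
      C₁ * Real.sqrt (F ν ^ 3 * D2 F ν p p * D2 F ν q q * D2 F ν r r)

/-- The "downward normal" covector `ν = Du − φ⁰ = (−1, ∂₁u, …, ∂ₙu)` of the graph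
of the time-`t` slice of `u` at `x`. -/
noncomputable def nuVec {n : ℕ} (u : (Fin n → ℝ) × ℝ → ℝ) (x : Fin n → ℝ) (t : ℝ) :
    Fin (n + 1) → ℝ :=
  Fin.cons (-1) fun i => fderiv ℝ (fun y => u (y, t)) x (Pi.single i 1)

/-- Second spatial partial derivative `∂ᵢ∂ⱼ u` at `(x, t)`. -/
noncomputable def pd2 {n : ℕ} (u : (Fin n → ℝ) × ℝ → ℝ) (x : Fin n → ℝ) (t : ℝ)
    (i j : Fin n) : ℝ :=
  fderiv ℝ (fun y => fderiv ℝ (fun z => u (z, t)) y (Pi.single j 1)) x (Pi.single i 1)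

/-- `u` is a `C³` solution of the anisotropic mean curvature flow for graphs on
`ℝⁿ × [0, T]`: `∂ₜu = Σᵢⱼ F(ν)·D²F|_ν(φⁱ,φʲ)·∂ᵢ∂ⱼu` with `ν = Du − φ⁰`. -/
def IsFlowSolution {n : ℕ} (F : (Fin (n + 1) → ℝ) → ℝ)
    (u : (Fin n → ℝ) × ℝ → ℝ) (T : ℝ) : Prop :=
  ContDiffOn ℝ 3 u (Set.univ ×ˢ Set.Icc 0 T) ∧
  ∀ (x : Fin n → ℝ) (t : ℝ), t ∈ Set.Icc 0 T →
    deriv (fun s => u (x, s)) t =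
      ∑ i : Fin n, ∑ j : Fin n,
        F (nuVec u x t) *
          D2 F (nuVec u x t) (Pi.single i.succ 1) (Pi.single j.succ 1) *
          pd2 u x t i j

set_option maxSynthPendingDepth 3

section Homogeneous
variable {E G : Type*} [NormedAddCommGroup E] [NormedSpace ℝ E]
  [NormedAddCommGroup G] [NormedSpace ℝ G]

/-- The derivative of a function invariant under positive dilations vanishes radially. -/
lemma fderiv_radial_eq_zero {g : E → G} {ν : E} (hg : DifferentiableAt ℝ g ν)
    (h : ∀ c : ℝ, 0 < c → g (c • ν) = g ν) : fderiv ℝ g ν ν = 0 := by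
  have h1 : HasDerivAt (fun s : ℝ => s • ν) ν 1 := by
    simpa using (hasDerivAt_id (1 : ℝ)).smul_const ν
  have h2 : HasDerivAt (fun s : ℝ => g (s • ν)) (fderiv ℝ g ν ν) 1 := by
    have h3 : HasFDerivAt g (fderiv ℝ g ν) ((1 : ℝ) • ν) := by simpa using hg.hasFDerivAt
    exact h3.comp_hasDerivAt 1 h1
  have h4 : (fun s : ℝ => g (s • ν)) =ᶠ[nhds 1] fun _ => g ν := by
    filter_upwards [lt_mem_nhds (zero_lt_one' ℝ)] with s hs using h s hs
  exact h2.unique ((hasDerivAt_const (1 : ℝ) (g ν)).congr_of_eventuallyEq h4)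

/-- The derivative of a positively `0`-homogeneous map is `(-1)`-homogeneous. -/
lemma fderiv_smul_of_homogeneous_zero {g : E → G}
    (h : ∀ (c : ℝ) (v : E), 0 < c → g (c • v) = g v) {c : ℝ} (hc : 0 < c) (v : E) :
    c • fderiv ℝ g (c • v) = fderiv ℝ g v := by
  rw [← fderiv_comp_smul]
  congr 1
  ext w
  exact h c w hc

/-- The derivative of a positively `1`-homogeneous map is `0`-homogeneous. -/
lemma fderiv_smul_of_homogeneous_one {g : E → G}
    (h : ∀ (c : ℝ) (v : E), 0 < c → g (c • v) = c • g v) {c : ℝ} (hc : 0 < c) (v : E) :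
    fderiv ℝ g (c • v) = fderiv ℝ g v := by
  have h1 := fderiv_comp_smul (𝕜 := ℝ) (f := g) (x := v) c
  have h2 : (fun x => g (c • x)) = c • g := by
    ext w
    exact h c w hc
  rw [h2, fderiv_const_smul_field] at h1
  exact ((smul_right_injective _ hc.ne') h1).symm

end Homogeneous

/-- The form `F(ν) D²F|_ν`. -/
noncomputable def anisoForm {E : Type*} [NormedAddCommGroup E] [NormedSpace ℝ E]
    (F : E → ℝ) (ν : E) : E →L[ℝ] E →L[ℝ] ℝ :=
  F ν • fderiv ℝ (fderiv ℝ F) ν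

lemma anisoForm_apply_eq {E : Type*} [NormedAddCommGroup E] [NormedSpace ℝ E]
    (F : E → ℝ) (ν v w : E) : anisoForm F ν v w = F ν * D2 F ν v w := by
  simp [anisoForm, D2, iteratedFDeriv_two_apply]

namespace IsAreaIntegrand
variable {n : ℕ} {F : (Fin (n + 1) → ℝ) → ℝ}

lemma contDiffAt (hF : IsAreaIntegrand F) {ν : Fin (n + 1) → ℝ} (hν : ν ≠ 0) : ContDiffAt ℝ 3 F ν :=
  hF.2.2.1.contDiffAt (isOpen_compl_singleton.mem_nhds hν)

lemma contDiffOn_anisoForm (hF : IsAreaIntegrand F) : ContDiffOn ℝ 1 (anisoForm F) {0}ᶜ := by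
  have ho : IsOpen ({0}ᶜ : Set (Fin (n + 1) → ℝ)) := isOpen_compl_singleton
  have h1 : ContDiffOn ℝ 2 (fderiv ℝ F) {0}ᶜ := hF.2.2.1.fderiv_of_isOpen ho (by norm_num)
  have h2 : ContDiffOn ℝ 1 (fderiv ℝ (fderiv ℝ F)) {0}ᶜ := h1.fderiv_of_isOpen ho (by norm_num)
  exact (hF.2.2.1.of_le (by norm_num)).smul h2

lemma differentiableAt_anisoForm (hF : IsAreaIntegrand F) {ν : Fin (n + 1) → ℝ} (hν : ν ≠ 0) :
    DifferentiableAt ℝ (anisoForm F) ν :=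
  (hF.contDiffOn_anisoForm.contDiffAt (isOpen_compl_singleton.mem_nhds hν)).differentiableAt
    (by norm_num)

lemma continuousOn_fderiv_anisoForm (hF : IsAreaIntegrand F) : ContinuousOn
    (fderiv ℝ (anisoForm F)) {0}ᶜ :=
  hF.contDiffOn_anisoForm.continuousOn_fderiv_of_isOpen isOpen_compl_singleton le_rfl

lemma anisoForm_smul (hF : IsAreaIntegrand F) (c : ℝ) (ν : Fin (n + 1) → ℝ) (hc : 0 < c) :
    anisoForm F (c • ν) = anisoForm F ν := by
  have h1 : ∀ (c : ℝ) (v : Fin (n + 1) → ℝ), 0 < c → fderiv ℝ F (c • v) = fderiv ℝ F v :=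
    fun c v hc => fderiv_smul_of_homogeneous_one (fun c v hc => hF.2.2.2.1 c v hc) hc v
  have h2 := fderiv_smul_of_homogeneous_zero h1 hc ν
  rw [anisoForm, anisoForm, hF.2.2.2.1 c ν hc, ← h2, smul_smul, mul_comm]

lemma fderiv_anisoForm_smul (hF : IsAreaIntegrand F) {c : ℝ} (hc : 0 < c) (ν : Fin (n + 1) → ℝ) :
    c • fderiv ℝ (anisoForm F) (c • ν) = fderiv ℝ (anisoForm F) ν :=
  fderiv_smul_of_homogeneous_zero hF.anisoForm_smul hc ν

lemma anisoForm_self (hF : IsAreaIntegrand F) {ν : Fin (n + 1) → ℝ}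
    (hν : ν ≠ 0) : anisoForm F ν ν = 0 := by
  have h1 : ∀ (c : ℝ), 0 < c → fderiv ℝ F (c • ν) = fderiv ℝ F ν :=
    fun c hc => fderiv_smul_of_homogeneous_one (fun c v hc => hF.2.2.2.1 c v hc) hc ν
  have h2 : DifferentiableAt ℝ (fderiv ℝ F) ν :=
    ((hF.contDiffAt hν).fderiv_right (m := 2) (by norm_num)).differentiableAt (by norm_num)
  simp [anisoForm, fderiv_radial_eq_zero h2 h1]

lemma anisoForm_symm (hF : IsAreaIntegrand F) {ν : Fin (n + 1) → ℝ} (hν : ν ≠ 0)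
    (v w : Fin (n + 1) → ℝ) :
    anisoForm F ν v w = anisoForm F ν w v := by
  have h := (hF.contDiffAt hν).isSymmSndFDerivAt (by norm_num)
  simp [anisoForm, h.eq v w]

lemma anisoForm_pos (hF : IsAreaIntegrand F) {ν w : Fin (n + 1) → ℝ} (hν : ν ≠ 0)
    (hw : ∀ c : ℝ, w ≠ c • ν) :
    0 < anisoForm F ν w w := by
  rw [anisoForm_apply_eq]
  exact mul_pos (hF.1 ν hν) (hF.2.2.2.2 ν w hν hw)

lemma anisoForm_nonneg (hF : IsAreaIntegrand F) {ν : Fin (n + 1) → ℝ} (hν : ν ≠ 0)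
    (w : Fin (n + 1) → ℝ) :
    0 ≤ anisoForm F ν w w := by
  by_cases hw : ∀ c : ℝ, w ≠ c • ν
  · exact (hF.anisoForm_pos hν hw).le
  · push Not at hw
    obtain ⟨c, rfl⟩ := hw
    simp [hF.anisoForm_self hν]

lemma fderiv_anisoForm_self (hF : IsAreaIntegrand F) {ν : Fin (n + 1) → ℝ} (hν : ν ≠ 0) :
    fderiv ℝ (anisoForm F) ν ν = 0 :=
  fderiv_radial_eq_zero (hF.differentiableAt_anisoForm hν) fun c hc => hF.anisoForm_smul c ν hc

lemma fderiv_anisoForm_apply_self (hF : IsAreaIntegrand F) {ν : Fin (n + 1) → ℝ} (hν : ν ≠ 0)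
    (z w : Fin (n + 1) → ℝ) :
    fderiv ℝ (anisoForm F) ν z ν w = - anisoForm F ν z w := by
  have h1 : HasFDerivAt (fun μ => anisoForm F μ μ) _ ν :=
    (hF.differentiableAt_anisoForm hν).hasFDerivAt.clm_apply (hasFDerivAt_id ν)
  have h2 : (fun μ => anisoForm F μ μ) =ᶠ[nhds ν] fun _ => 0 := by
    filter_upwards [isOpen_compl_singleton.mem_nhds hν] with μ hμ using hF.anisoForm_self hμ
  have h3 := h1.unique ((hasFDerivAt_const _ ν).congr_of_eventuallyEq h2)
  have h4 := DFunLike.congr_fun (DFunLike.congr_fun h3 z) w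
  simp at h4
  linarith

lemma fderiv_anisoForm_symm (hF : IsAreaIntegrand F) {ν : Fin (n + 1) → ℝ} (hν : ν ≠ 0)
    (z v w : Fin (n + 1) → ℝ) :
    fderiv ℝ (anisoForm F) ν z v w = fderiv ℝ (anisoForm F) ν z w v := by
  have hd := (hF.differentiableAt_anisoForm hν).hasFDerivAt
  have h1 : ∀ v w, HasFDerivAt (fun μ => anisoForm F μ v w) _ ν := fun v w =>
    (hd.clm_apply (hasFDerivAt_const v ν)).clm_apply (hasFDerivAt_const w ν)
  have h2 : (fun μ => anisoForm F μ v w) =ᶠ[nhds ν] fun μ => anisoForm F μ w v := by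
    filter_upwards [isOpen_compl_singleton.mem_nhds hν] with μ hμ using hF.anisoForm_symm hμ v w
  have h3 := (h1 v w).unique ((h1 w v).congr_of_eventuallyEq h2)
  simpa using DFunLike.congr_fun h3 z

lemma exists_anisoForm_bound (hF : IsAreaIntegrand F) : ∃ C > 0, ∀ ν : Fin (n + 1) → ℝ, ν ≠ 0 →
    ‖anisoForm F ν‖ ≤ C ∧ ‖ν‖ * ‖fderiv ℝ (anisoForm F) ν‖ ≤ C := by
  have hs : Metric.sphere (0 : Fin (n + 1) → ℝ) 1 ⊆ {0}ᶜ := by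
    intro ν hν h
    simp_all
  have hc := isCompact_sphere (0 : Fin (n + 1) → ℝ) 1
  obtain ⟨C₁, h₁⟩ := hc.exists_bound_of_continuousOn (hF.contDiffOn_anisoForm.continuousOn.mono hs)
  obtain ⟨C₂, h₂⟩ := hc.exists_bound_of_continuousOn (hF.continuousOn_fderiv_anisoForm.mono hs)
  refine ⟨max 1 (max C₁ C₂), by positivity, fun ν hν => ?_⟩
  have hp : 0 < ‖ν‖ := norm_pos_iff.2 hν
  have hm : ‖ν‖⁻¹ • ν ∈ Metric.sphere (0 : Fin (n + 1) → ℝ) 1 := by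
    simp [norm_smul, hp.ne']
  constructor
  · rw [← hF.anisoForm_smul ‖ν‖⁻¹ ν (by positivity)]
    exact (h₁ _ hm).trans (by simp)
  · have h := h₂ _ hm
    have h3 := hF.fderiv_anisoForm_smul (c := ‖ν‖⁻¹) (by positivity) ν
    rw [← h3, norm_smul]
    simp only [norm_inv, norm_norm]
    rw [mul_inv_cancel_left₀ hp.ne']
    exact h.trans (by simp)

lemma exists_anisoForm_coercive (hF : IsAreaIntegrand F) : ∃ c > 0, ∀ ν w : Fin (n + 1) → ℝ, ν ≠ 0 →
    c * (w ⬝ᵥ w - (w ⬝ᵥ ν) ^ 2 / (ν ⬝ᵥ ν)) ≤ anisoForm F ν w w := by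
  set S := Metric.sphere (0 : Fin (n + 1) → ℝ) 1
  have hs : S ⊆ {0}ᶜ := by
    intro ν hν h
    simp_all [S]
  have hK : IsCompact (S ×ˢ S) := (isCompact_sphere _ _).prod (isCompact_sphere _ _)
  have hcont : ContinuousOn (fun z : (Fin (n + 1) → ℝ) × (Fin (n + 1) → ℝ) =>
      anisoForm F z.1 z.2 z.2 + (z.2 ⬝ᵥ z.1) ^ 2) (S ×ˢ S) := by
    have h1 : ContinuousOn (fun z : (Fin (n + 1) → ℝ) × (Fin (n + 1) → ℝ) =>
        anisoForm F z.1) (S ×ˢ S) :=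
      (hF.contDiffOn_anisoForm.continuousOn.mono hs).comp continuousOn_fst fun z hz => hz.1
    have h2 : Continuous (fun z : (Fin (n + 1) → ℝ) × (Fin (n + 1) → ℝ) => (z.2 ⬝ᵥ z.1) ^ 2) := by
      simp only [dotProduct]
      fun_prop
    exact ((h1.clm_apply continuousOn_snd).clm_apply continuousOn_snd).add h2.continuousOn
  have hne : (S ×ˢ S).Nonempty := by
    obtain ⟨v, hv⟩ := NormedSpace.sphere_nonempty (E := Fin (n + 1) → ℝ) (x := 0).2 zero_le_one
    exact ⟨(v, v), hv, hv⟩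
  obtain ⟨⟨ν₀, w₀⟩, ⟨h0, h0'⟩, hmin⟩ := hK.exists_isMinOn hne hcont
  set m := anisoForm F ν₀ w₀ w₀ + (w₀ ⬝ᵥ ν₀) ^ 2
  have hν₀ : ν₀ ≠ 0 := hs h0
  have hw₀ : w₀ ≠ 0 := hs h0'
  have hm : 0 < m := by
    by_cases h : ∀ c : ℝ, w₀ ≠ c • ν₀
    · have := hF.anisoForm_pos hν₀ h
      positivity
    · push Not at h
      obtain ⟨c, rfl⟩ := h
      have hc : c ≠ 0 := by
        rintro rfl
        simp at hw₀
      have h1 := hF.anisoForm_nonneg hν₀ (c • ν₀)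
      have h2 : 0 < ν₀ ⬝ᵥ ν₀ := by
        refine lt_of_le_of_ne (Finset.sum_nonneg fun i _ => mul_self_nonneg _) ?_
        exact fun h => hν₀ (dotProduct_self_eq_zero.1 h.symm)
      have h3 : 0 < (c * (ν₀ ⬝ᵥ ν₀)) ^ 2 := by positivity
      simp only [smul_dotProduct, smul_eq_mul, m]
      linarith
  refine ⟨m / (n + 1), by positivity, fun ν w hν => ?_⟩
  have hνν : 0 < ν ⬝ᵥ ν := by
    refine lt_of_le_of_ne (Finset.sum_nonneg fun i _ => mul_self_nonneg _) ?_
    exact fun h => hν (dotProduct_self_eq_zero.1 h.symm)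
  set t := (w ⬝ᵥ ν) / (ν ⬝ᵥ ν) with ht
  set q := w - t • ν with hq
  have hqν : q ⬝ᵥ ν = 0 := by
    rw [hq, sub_dotProduct, smul_dotProduct, smul_eq_mul, ht]
    field_simp
    ring
  have hqq : w ⬝ᵥ w - (w ⬝ᵥ ν) ^ 2 / (ν ⬝ᵥ ν) = q ⬝ᵥ q := by
    have : q ⬝ᵥ q = q ⬝ᵥ w := by
      conv_lhs => rw [hq, dotProduct_sub, dotProduct_smul, ← hq, hqν]
      simp
    rw [this, hq, sub_dotProduct, smul_dotProduct, smul_eq_mul, ht, dotProduct_comm ν w]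
    field_simp
  have hform : anisoForm F ν w w = anisoForm F ν q q := by
    have h1 := hF.anisoForm_self hν
    have h2 := hF.anisoForm_symm hν q ν
    rw [h1] at h2
    have : w = q + t • ν := by simp [hq]
    rw [this]
    simp only [map_add, map_smul, h1]
    simp [h2]
  rw [hqq, hform]
  by_cases hq0 : q = 0
  · simp [hq0]
  have hqp : 0 < ‖q‖ := norm_pos_iff.2 hq0
  have hνp : 0 < ‖ν‖ := norm_pos_iff.2 hν
  have h1 : m ≤ anisoForm F ν (‖q‖⁻¹ • q) (‖q‖⁻¹ • q) := by
    have h := hmin (a := (‖ν‖⁻¹ • ν, ‖q‖⁻¹ • q))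
      ⟨by simp [S, norm_smul, hνp.ne'], by simp [S, norm_smul, hqp.ne']⟩
    simp only [mem_ofPred_eq, smul_dotProduct, dotProduct_smul, hqν] at h
    rw [hF.anisoForm_smul _ _ (by positivity)] at h
    simpa using h
  have h2 : anisoForm F ν (‖q‖⁻¹ • q) (‖q‖⁻¹ • q) = (‖q‖ ^ 2)⁻¹ * anisoForm F ν q q := by
    simp
    ring
  rw [h2, inv_mul_eq_div, le_div_iff₀ (by positivity)] at h1
  have h3 : q ⬝ᵥ q ≤ (n + 1) * ‖q‖ ^ 2 := by
    have : ∀ i ∈ Finset.univ, q i * q i ≤ ‖q‖ ^ 2 := fun i _ => by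
      have := norm_le_pi_norm q i
      rw [← pow_two, ← sq_abs]
      exact pow_le_pow_left₀ (abs_nonneg _) this 2
    have := Finset.sum_le_card_nsmul _ _ _ this
    simpa [dotProduct] using this
  calc m / (n + 1) * (q ⬝ᵥ q) ≤ m / (n + 1) * ((n + 1) * ‖q‖ ^ 2) := by gcongr
    _ = m * ‖q‖ ^ 2 := by field_simp
    _ ≤ _ := h1

end IsAreaIntegrand

/-- The inclusion of horizontal covectors. -/
noncomputable def horizontal (n : ℕ) : (Fin n → ℝ) →L[ℝ] (Fin (n + 1) → ℝ) :=
  ∑ i, (ContinuousLinearMap.proj (R := ℝ) (φ := fun _ : Fin n => ℝ) i).smulRight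
    (Pi.single i.succ (1 : ℝ) : Fin (n + 1) → ℝ)

section Horizontal
variable {n : ℕ}

lemma horizontal_apply (ξ : Fin n → ℝ) :
    horizontal n ξ = ∑ i, ξ i • (Pi.single i.succ (1 : ℝ) : Fin (n + 1) → ℝ) := by
  simp [horizontal]

@[simp] lemma horizontal_zero (ξ : Fin n → ℝ) : horizontal n ξ 0 = 0 := by
  simp [horizontal_apply]

@[simp] lemma horizontal_succ (ξ : Fin n → ℝ) (i : Fin n) : horizontal n ξ i.succ = ξ i := by
  simp [horizontal_apply, Pi.single_apply]

lemma horizontal_single (i : Fin n) :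
    horizontal n (Pi.single i 1) = Pi.single i.succ 1 := by
  ext j
  refine Fin.cases ?_ (fun k => ?_) j
  · simp [(Fin.succ_ne_zero i).symm]
  · simp [Pi.single_apply]

@[simp] lemma norm_horizontal (ξ : Fin n → ℝ) : ‖horizontal n ξ‖ = ‖ξ‖ := by
  apply le_antisymm
  · refine (pi_norm_le_iff_of_nonneg (norm_nonneg _)).2 fun j => ?_
    refine Fin.cases ?_ (fun k => ?_) j
    · simp
    · simpa using norm_le_pi_norm ξ k
  · refine (pi_norm_le_iff_of_nonneg (norm_nonneg _)).2 fun j => ?_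
    simpa using norm_le_pi_norm (horizontal n ξ) j.succ

lemma cons_neg_one_eq (p : Fin n → ℝ) :
    (Fin.cons (-1) p : Fin (n + 1) → ℝ) = horizontal n p - Pi.single 0 1 := by
  ext j
  refine Fin.cases ?_ (fun k => ?_) j
  · simp
  · simp [Fin.succ_ne_zero]

lemma cons_neg_one_ne_zero (p : Fin n → ℝ) : (Fin.cons (-1) p : Fin (n + 1) → ℝ) ≠ 0 := by
  intro h
  simpa using congrFun h 0

lemma norm_le_norm_cons_neg_one (p : Fin n → ℝ) :
    ‖p‖ ≤ ‖(Fin.cons (-1) p : Fin (n + 1) → ℝ)‖ := by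
  refine (pi_norm_le_iff_of_nonneg (norm_nonneg _)).2 fun j => ?_
  simpa using norm_le_pi_norm (Fin.cons (-1) p : Fin (n + 1) → ℝ) j.succ

lemma one_le_norm_cons_neg_one (p : Fin n → ℝ) :
    1 ≤ ‖(Fin.cons (-1) p : Fin (n + 1) → ℝ)‖ := by
  simpa using norm_le_pi_norm (Fin.cons (-1) p : Fin (n + 1) → ℝ) 0

end Horizontal

/-- Reflection in the vertical coordinate. -/
noncomputable def verticalReflection (n : ℕ) : (Fin (n + 1) → ℝ) →L[ℝ] (Fin (n + 1) → ℝ) :=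
  ContinuousLinearMap.id ℝ _ - (2 : ℝ) •
    (ContinuousLinearMap.proj (R := ℝ) (φ := fun _ : Fin (n + 1) => ℝ) 0).smulRight
      (Pi.single 0 (1 : ℝ) : Fin (n + 1) → ℝ)

lemma verticalReflection_apply {n : ℕ} (v : Fin (n + 1) → ℝ) :
    verticalReflection n v = v - (2 * v 0) • Pi.single 0 1 := by
  simp [verticalReflection, mul_smul]

lemma verticalReflection_involutive {n : ℕ} (v : Fin (n + 1) → ℝ) :
    verticalReflection n (verticalReflection n v) = v := by
  ext j
  simp only [verticalReflection_apply, Pi.sub_apply, Pi.smul_apply, smul_eq_mul, Pi.single_eq_same]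
  ring

lemma verticalReflection_ne_zero {n : ℕ} {v : Fin (n + 1) → ℝ} (hv : v ≠ 0) :
    verticalReflection n v ≠ 0 := fun h => hv (by
  rw [← verticalReflection_involutive v, h, map_zero])

lemma verticalReflection_of_eq_zero {n : ℕ} {v : Fin (n + 1) → ℝ} (hv : v 0 = 0) :
    verticalReflection n v = v := by
  simp [verticalReflection_apply, hv]

lemma verticalReflection_single {n : ℕ} :
    verticalReflection n (Pi.single 0 1) = - Pi.single 0 1 := by
  ext j
  simp [verticalReflection_apply]
  ring

namespace IsAreaIntegrand
variable {n : ℕ} {F : (Fin (n + 1) → ℝ) → ℝ}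

lemma apply_verticalReflection (hF : IsAreaIntegrand F) (hsym : SymmCond F) (v : Fin (n + 1) → ℝ) :
    F (verticalReflection n v) = F v := by
  have key : ∀ (p : Fin (n + 1) → ℝ) (s : ℝ), p 0 = 0 → 0 < s →
      F (p + s • Pi.single 0 1) = F (p - s • Pi.single 0 1) := by
    intro p s hp hs
    have h := hsym (s⁻¹ • p) (by simp [hp])
    have h1 := hF.2.2.2.1 s (s⁻¹ • p + Pi.single 0 1) hs
    have h2 := hF.2.2.2.1 s (s⁻¹ • p - Pi.single 0 1) hs
    rw [smul_add, smul_inv_smul₀ hs.ne'] at h1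
    rw [smul_sub, smul_inv_smul₀ hs.ne'] at h2
    rw [h1, h2, h]
  set p := v - v 0 • (Pi.single 0 1 : Fin (n + 1) → ℝ) with hp
  have hp0 : p 0 = 0 := by simp [hp]
  have hv : v = p + v 0 • Pi.single 0 1 := by simp [hp]
  have hrv : verticalReflection n v = p - v 0 • Pi.single 0 1 := by
    rw [verticalReflection_apply, hp, two_mul, add_smul]
    abel
  rw [hrv]
  conv_rhs => rw [hv]
  rcases lt_trichotomy (v 0) 0 with h | h | h
  · have := key p (-(v 0)) hp0 (by linarith)
    simp only [neg_smul, sub_neg_eq_add] at this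
    rw [← this, sub_eq_add_neg]
  · simp [h]
  · exact (key p _ hp0 h).symm

lemma anisoForm_verticalReflection (hF : IsAreaIntegrand F) (hsym : SymmCond F)
    {ν : Fin (n + 1) → ℝ} (hν : ν ≠ 0)
    (v w : Fin (n + 1) → ℝ) :
    anisoForm F (verticalReflection n ν) (verticalReflection n v) (verticalReflection n w) =
      anisoForm F ν v w := by
  set ρ := verticalReflection n
  have h1 : ∀ x : Fin (n + 1) → ℝ, x ≠ 0 → ∀ y, fderiv ℝ F (ρ x) (ρ y) = fderiv ℝ F x y := by
    intro x hx y
    have hd : HasFDerivAt F (fderiv ℝ F (ρ x)) (ρ x) :=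
      ((hF.contDiffAt (verticalReflection_ne_zero hx)).differentiableAt (by norm_num)).hasFDerivAt
    have h2 := hd.comp x ρ.hasFDerivAt
    have h3 : F ∘ ρ = F := funext fun v => hF.apply_verticalReflection hsym v
    rw [h3] at h2
    rw [h2.fderiv]
    rfl
  have hd2 : ∀ x : Fin (n + 1) → ℝ, x ≠ 0 →
      HasFDerivAt (fderiv ℝ F) (fderiv ℝ (fderiv ℝ F) x) x := fun x hx =>
    (((hF.contDiffAt hx).fderiv_right (m := 2) (by norm_num)).differentiableAt
      (by norm_num)).hasFDerivAt
  have h4 := ((hd2 _ (verticalReflection_ne_zero hν)).comp ν ρ.hasFDerivAt).clm_apply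
    (hasFDerivAt_const (ρ w) ν)
  have h5 := (hd2 ν hν).clm_apply (hasFDerivAt_const w ν)
  have h6 : (fun x => fderiv ℝ F x w) =ᶠ[nhds ν] fun x => fderiv ℝ F (ρ x) (ρ w) := by
    filter_upwards [isOpen_compl_singleton.mem_nhds hν] with x hx using (h1 x hx w).symm
  have h7 := DFunLike.congr_fun (h4.unique (h5.congr_of_eventuallyEq h6.symm)) v
  simp at h7
  simp only [anisoForm, ρ, hF.apply_verticalReflection hsym]
  simp only [smul_apply]
  rw [h7]

lemma fderiv_anisoForm_equator (hF : IsAreaIntegrand F) (hsym : SymmCond F) {ν : Fin (n + 1) → ℝ}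
    (hν : ν ≠ 0)
    (hν0 : ν 0 = 0) {v w : Fin (n + 1) → ℝ}
    (hvw : (verticalReflection n v = v ∧ verticalReflection n w = w) ∨
      (verticalReflection n v = -v ∧ verticalReflection n w = -w)) :
    fderiv ℝ (anisoForm F) ν (Pi.single 0 1) v w = 0 := by
  have h1 : HasFDerivAt (fun μ => anisoForm F μ v w) _ ν :=
    ((hF.differentiableAt_anisoForm hν).hasFDerivAt.clm_apply (hasFDerivAt_const v ν)).clm_apply
      (hasFDerivAt_const w ν)
  have h1' := h1
  rw [← verticalReflection_of_eq_zero hν0] at h1'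
  have h2 := h1'.comp ν (verticalReflection n).hasFDerivAt
  have h3 : (fun μ => anisoForm F μ v w) =ᶠ[nhds ν]
      (fun μ => anisoForm F μ v w) ∘ (verticalReflection n) := by
    filter_upwards [isOpen_compl_singleton.mem_nhds hν] with μ hμ
    have := hF.anisoForm_verticalReflection hsym hμ v w
    rcases hvw with ⟨hv, hw⟩ | ⟨hv, hw⟩ <;> rw [hv, hw] at this <;> simpa using this.symm
  have h4 := DFunLike.congr_fun (h1.unique (h2.congr_of_eventuallyEq h3)) (Pi.single 0 1)
  simp only [verticalReflection_of_eq_zero hν0] at h4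
  simp [verticalReflection_single] at h4
  linarith

lemma fderiv_anisoForm_near_equator (hF : IsAreaIntegrand F) (hsym : SymmCond F) {ε : ℝ}
    (hε : 0 < ε) :
    ∃ δ > 0, ∀ ν : Fin (n + 1) → ℝ, ν ≠ 0 → |ν 0| ≤ δ * ‖ν‖ →
      (∀ ξ η : Fin n → ℝ, ‖ν‖ *
        |fderiv ℝ (anisoForm F) ν (Pi.single 0 1) (horizontal n ξ) (horizontal n η)| ≤
          ε * ‖ξ‖ * ‖η‖) ∧
      ‖ν‖ * |fderiv ℝ (anisoForm F) ν (Pi.single 0 1) (Pi.single 0 1) (Pi.single 0 1)| ≤ ε := by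
  set e : Fin (n + 1) → (Fin (n + 1) → ℝ) := fun i => Pi.single i 1
  set D : (Fin (n + 1) → ℝ) → (Fin (n + 1) → ℝ) →L[ℝ] (Fin (n + 1) → ℝ) →L[ℝ] ℝ :=
    fun ν => fderiv ℝ (anisoForm F) ν (e 0) with hD
  set Ψ : (Fin (n + 1) → ℝ) → ℝ := fun ν =>
    (∑ i : Fin n, ∑ j : Fin n, |D ν (e i.succ) (e j.succ)|) + |D ν (e 0) (e 0)| with hΨ
  have hDc : ContinuousOn D {0}ᶜ := hF.continuousOn_fderiv_anisoForm.clm_apply continuousOn_const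
  have hDc' : ∀ v w, ContinuousOn (fun ν => |D ν v w|) {0}ᶜ := fun v w =>
    ((hDc.clm_apply continuousOn_const).clm_apply continuousOn_const).abs
  have hΨc : ContinuousOn Ψ {0}ᶜ :=
    (continuousOn_finsetSum _ fun i _ => continuousOn_finsetSum _ fun j _ => hDc' _ _).add
      (hDc' _ _)
  set S := Metric.sphere (0 : Fin (n + 1) → ℝ) 1
  have hs : S ⊆ {0}ᶜ := by
    intro ν hν h
    simp_all [S]
  have hS : IsCompact S := isCompact_sphere _ _
  have hequator : ∀ ν ∈ S, ν 0 = 0 → Ψ ν = 0 := by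
    intro ν hν h0
    have h1 : ∀ i j : Fin n, D ν (e i.succ) (e j.succ) = 0 := fun i j =>
      hF.fderiv_anisoForm_equator hsym (hs hν) h0 (Or.inl
        ⟨verticalReflection_of_eq_zero (by simp [e, (Fin.succ_ne_zero _).symm]),
          verticalReflection_of_eq_zero (by simp [e, (Fin.succ_ne_zero _).symm])⟩)
    have h2 : D ν (e 0) (e 0) = 0 := hF.fderiv_anisoForm_equator hsym (hs hν) h0
      (Or.inr ⟨verticalReflection_single, verticalReflection_single⟩)
    simp [hΨ, h1, h2]
  have hδ : ∃ δ > 0, ∀ ν ∈ S, |ν 0| ≤ δ → Ψ ν ≤ ε := by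
    have hK : IsCompact (S ∩ Ψ ⁻¹' Ici ε) :=
      hS.of_isClosed_subset ((hΨc.mono hs).preimage_isClosed_of_isClosed hS.isClosed isClosed_Ici)
        inter_subset_left
    rcases (S ∩ Ψ ⁻¹' Ici ε).eq_empty_or_nonempty with he | hne
    · refine ⟨1, one_pos, fun ν hν _ => ?_⟩
      by_contra! h
      have : ν ∈ S ∩ Ψ ⁻¹' Ici ε := ⟨hν, h.le⟩
      simp [he] at this
    · obtain ⟨ν₀, hν₀, hmin⟩ := hK.exists_isMinOn (f := fun ν => |ν 0|) hne
        (by fun_prop)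
      have hpos : 0 < |ν₀ 0| := by
        rw [abs_pos]
        intro h
        have h1 := hequator ν₀ hν₀.1 h
        have h2 : ε ≤ Ψ ν₀ := hν₀.2
        linarith
      refine ⟨|ν₀ 0| / 2, by positivity, fun ν hν h => ?_⟩
      by_contra! h'
      have h3 : |ν₀ 0| ≤ |ν 0| := hmin (show ν ∈ S ∩ Ψ ⁻¹' Ici ε from ⟨hν, h'.le⟩)
      linarith
  obtain ⟨δ, hδ0, hδ⟩ := hδ
  refine ⟨δ, hδ0, fun ν hν hν0 => ?_⟩
  have hp : 0 < ‖ν‖ := norm_pos_iff.2 hν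
  have hm : ‖ν‖⁻¹ • ν ∈ S := by simp [S, norm_smul, hp.ne']
  have hΨν : Ψ (‖ν‖⁻¹ • ν) ≤ ε := by
    refine hδ _ hm ?_
    rw [Pi.smul_apply, smul_eq_mul, abs_mul, abs_of_pos (inv_pos.2 hp), inv_mul_le_iff₀ hp]
    linarith
  have hscale : ∀ v w, ‖ν‖ * |D ν v w| = |D (‖ν‖⁻¹ • ν) v w| := by
    intro v w
    have h := hF.fderiv_anisoForm_smul (inv_pos.2 hp) ν
    simp only [hD]
    rw [← h]
    simp only [smul_apply, smul_eq_mul, abs_mul, abs_inv, abs_norm]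
    rw [mul_inv_cancel_left₀ hp.ne']
  constructor
  · intro ξ η
    change ‖ν‖ * |D ν _ _| ≤ _
    rw [hscale, horizontal_apply, horizontal_apply]
    simp only [map_sum, map_smul, sum_apply, smul_apply,
      smul_eq_mul]
    calc |∑ j : Fin n, η j * ∑ i : Fin n, ξ i * D (‖ν‖⁻¹ • ν) (e i.succ) (e j.succ)|
        ≤ ∑ j : Fin n, ‖η‖ * ∑ i : Fin n, ‖ξ‖ * |D (‖ν‖⁻¹ • ν) (e i.succ) (e j.succ)| := by
          refine (Finset.abs_sum_le_sum_abs _ _).trans (Finset.sum_le_sum fun j _ => ?_)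
          rw [abs_mul]
          refine mul_le_mul (norm_le_pi_norm η j) ?_ (abs_nonneg _) (norm_nonneg _)
          refine (Finset.abs_sum_le_sum_abs _ _).trans (Finset.sum_le_sum fun i _ => ?_)
          rw [abs_mul]
          exact mul_le_mul_of_nonneg_right (norm_le_pi_norm ξ i) (abs_nonneg _)
      _ = (∑ j : Fin n, ∑ i : Fin n, |D (‖ν‖⁻¹ • ν) (e i.succ) (e j.succ)|) * ‖ξ‖ * ‖η‖ := by
          simp only [← Finset.mul_sum]
          ring
      _ ≤ ε * ‖ξ‖ * ‖η‖ := by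
          gcongr
          rw [Finset.sum_comm]
          refine le_trans ?_ hΨν
          exact le_add_of_nonneg_right (abs_nonneg _)
  · change ‖ν‖ * |D ν _ _| ≤ _
    rw [hscale]
    refine le_trans ?_ hΨν
    exact le_add_of_nonneg_left (by positivity)

end IsAreaIntegrand

/-- The coefficients of the graphical flow, as a bilinear form depending on the gradient. -/
noncomputable def graphForm {n : ℕ} (F : (Fin (n + 1) → ℝ) → ℝ) (p : Fin n → ℝ) :
    (Fin n → ℝ) →L[ℝ] (Fin n → ℝ) →L[ℝ] ℝ :=
  (anisoForm F (Fin.cons (-1) p)).bilinearComp (horizontal n) (horizontal n)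

/-- Structure conditions on the coefficients `a` of the quasilinear equation
`∂ₜu = a(Du)ⁱʲ ∂ᵢ∂ⱼu`, modelled on mean curvature flow: `a p p p` stays of unit size for large
`p`, and the coefficients are asymptotically even in the vertical direction. -/
structure IsAsymptoticallyEven {n : ℕ}
    (a : (Fin n → ℝ) → (Fin n → ℝ) →L[ℝ] (Fin n → ℝ) →L[ℝ] ℝ) (c C : ℝ) : Prop where
  contDiff : ContDiff ℝ 1 a
  symm : ∀ p ξ η, a p ξ η = a p η ξ
  nonneg : ∀ p ξ, 0 ≤ a p ξ ξ
  bound : ∀ p ξ η, |a p ξ η| ≤ C * ‖ξ‖ * ‖η‖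
  bound_radial : ∀ p ξ, |a p p ξ| ≤ C * ‖ξ‖
  coercive : ∀ p ξ, p ≠ 0 → c * (ξ ⬝ᵥ ξ - (ξ ⬝ᵥ p) ^ 2 / (p ⬝ᵥ p)) ≤ a p ξ ξ
  fderiv_symm : ∀ p z ξ η, fderiv ℝ a p z ξ η = fderiv ℝ a p z η ξ
  fderiv_bound : ∀ p z ξ η, ‖p‖ * |fderiv ℝ a p z ξ η| ≤ C * ‖z‖ * ‖ξ‖ * ‖η‖
  fderiv_bound_radial : ∀ p z, |fderiv ℝ a p z p p| ≤ C * ‖z‖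
  asymptotic : ∀ ε > 0, ∃ P ≥ 1, ∀ p, P ≤ ‖p‖ → c ≤ a p p p ∧
    (∀ ξ η, ‖p‖ * |fderiv ℝ a p p ξ η| ≤ ε * ‖ξ‖ * ‖η‖) ∧
    |fderiv ℝ a p p p p + 2 * a p p p| ≤ ε

section GraphForm
variable {n : ℕ} {F : (Fin (n + 1) → ℝ) → ℝ}

lemma graphForm_apply (p ξ η : Fin n → ℝ) :
    graphForm F p ξ η = anisoForm F (Fin.cons (-1) p) (horizontal n ξ) (horizontal n η) := rfl

lemma hasFDerivAt_cons_neg_one (p : Fin n → ℝ) :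
    HasFDerivAt (fun p : Fin n → ℝ => (Fin.cons (-1) p : Fin (n + 1) → ℝ)) (horizontal n) p := by
  simp only [cons_neg_one_eq]
  exact (horizontal n).hasFDerivAt.sub_const _

end GraphForm

namespace IsAreaIntegrand
variable {n : ℕ} {F : (Fin (n + 1) → ℝ) → ℝ}

lemma contDiff_graphForm (hF : IsAreaIntegrand F) : ContDiff ℝ 1 (graphForm F) := by
  rw [contDiff_clm_apply_iff]
  intro ξ
  rw [contDiff_clm_apply_iff]
  intro η
  simp only [graphForm_apply]
  have h1 : ContDiff ℝ 1 (fun p : Fin n → ℝ => (Fin.cons (-1) p : Fin (n + 1) → ℝ)) := by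
    simp only [cons_neg_one_eq]
    exact (horizontal n).contDiff.sub contDiff_const
  have h2 : ContDiff ℝ 1 (fun p : Fin n → ℝ => anisoForm F (Fin.cons (-1) p)) := by
    rw [contDiff_iff_contDiffAt]
    intro p
    exact (hF.contDiffOn_anisoForm.contDiffAt
      (isOpen_compl_singleton.mem_nhds (cons_neg_one_ne_zero p))).comp p h1.contDiffAt
  exact (h2.clm_apply contDiff_const).clm_apply contDiff_const

lemma fderiv_graphForm_apply (hF : IsAreaIntegrand F) (p z ξ η : Fin n → ℝ) :
    fderiv ℝ (graphForm F) p z ξ η = fderiv ℝ (anisoForm F) (Fin.cons (-1) p)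
      (horizontal n z) (horizontal n ξ) (horizontal n η) := by
  have h1 := (((hF.contDiff_graphForm.differentiable (by norm_num) p).hasFDerivAt).clm_apply
    (hasFDerivAt_const ξ p)).clm_apply (hasFDerivAt_const η p)
  have h2 := (((hF.differentiableAt_anisoForm (cons_neg_one_ne_zero p)).hasFDerivAt.comp p
    (hasFDerivAt_cons_neg_one p)).clm_apply
      (hasFDerivAt_const (horizontal n ξ) p)).clm_apply (hasFDerivAt_const (horizontal n η) p)
  have h3 := DFunLike.congr_fun (h1.unique h2) z
  simpa using h3

lemma isAsymptoticallyEven_graphForm (hF : IsAreaIntegrand F) (hsym : SymmCond F) :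
    ∃ c > 0, ∃ C ≥ 1, IsAsymptoticallyEven (graphForm F) c C := by
  obtain ⟨c, hc, hcoer⟩ := hF.exists_anisoForm_coercive
  obtain ⟨C, hC, hb⟩ := hF.exists_anisoForm_bound
  set e : Fin (n + 1) → ℝ := Pi.single 0 1 with he
  have hne : ‖e‖ = 1 := by rw [he, Pi.norm_single, norm_one]
  have hν0 := cons_neg_one_ne_zero (n := n)
  have hp_eq : ∀ p : Fin n → ℝ, horizontal n p = Fin.cons (-1) p + e := fun p => by
    rw [cons_neg_one_eq, sub_add_cancel]
  have hbA : ∀ (p : Fin n → ℝ) v w,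
      |anisoForm F (Fin.cons (-1) p) v w| ≤ C * ‖v‖ * ‖w‖ := fun p v w => by
    refine ((anisoForm F (Fin.cons (-1) p)).le_opNorm₂ v w).trans ?_
    gcongr
    exact (hb _ (hν0 p)).1
  have hbD : ∀ (p : Fin n → ℝ) z v w, ‖(Fin.cons (-1) p : Fin (n + 1) → ℝ)‖ *
      |fderiv ℝ (anisoForm F) (Fin.cons (-1) p) z v w| ≤ C * ‖z‖ * ‖v‖ * ‖w‖ := fun p z v w => by
    have h1 := (fderiv ℝ (anisoForm F) (Fin.cons (-1) p) z).le_opNorm₂ v w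
    have h2 := (fderiv ℝ (anisoForm F) (Fin.cons (-1) p)).le_opNorm z
    have h3 := (hb _ (hν0 p)).2
    rw [Real.norm_eq_abs] at h1
    calc _ ≤ ‖(Fin.cons (-1) p : Fin (n + 1) → ℝ)‖ *
          (‖fderiv ℝ (anisoForm F) (Fin.cons (-1) p)‖ * ‖z‖ * ‖v‖ * ‖w‖) := by
            gcongr
            refine h1.trans ?_
            gcongr
      _ = ‖(Fin.cons (-1) p : Fin (n + 1) → ℝ)‖ *
          ‖fderiv ℝ (anisoForm F) (Fin.cons (-1) p)‖ * ‖z‖ * ‖v‖ * ‖w‖ := by ring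
      _ ≤ _ := by gcongr
  have hradial : ∀ p v, anisoForm F (Fin.cons (-1) p) (horizontal n p) v =
      anisoForm F (Fin.cons (-1) p) e v := fun p v => by
    rw [hp_eq, map_add, hF.anisoForm_self (hν0 p), zero_add]
  have hradial' : ∀ p, graphForm F p p p = anisoForm F (Fin.cons (-1) p) e e := fun p => by
    rw [graphForm_apply, hradial, hF.anisoForm_symm (hν0 p), hradial]
  have hDradial : ∀ p z, fderiv ℝ (anisoForm F) (Fin.cons (-1) p) z (horizontal n p)
      (horizontal n p) = fderiv ℝ (anisoForm F) (Fin.cons (-1) p) z e e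
        - 2 * anisoForm F (Fin.cons (-1) p) z e := fun p z => by
    have h1 : ∀ v, fderiv ℝ (anisoForm F) (Fin.cons (-1) p) z (horizontal n p) v =
        fderiv ℝ (anisoForm F) (Fin.cons (-1) p) z e v -
          anisoForm F (Fin.cons (-1) p) z v := fun v => by
      rw [hp_eq, map_add, add_apply, hF.fderiv_anisoForm_apply_self (hν0 p)]
      ring
    rw [h1, hF.fderiv_anisoForm_symm (hν0 p) z e, h1,
      hF.anisoForm_symm (hν0 p) z (horizontal n p), hradial, hF.anisoForm_symm (hν0 p) e z]
    ring
  have hDself : ∀ p, fderiv ℝ (anisoForm F) (Fin.cons (-1) p) (horizontal n p) =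
      fderiv ℝ (anisoForm F) (Fin.cons (-1) p) e := fun p => by
    rw [hp_eq, map_add, hF.fderiv_anisoForm_self (hν0 p), zero_add]
  have hdot : ∀ ξ η : Fin n → ℝ, horizontal n ξ ⬝ᵥ (Fin.cons (-1) η) = ξ ⬝ᵥ η := fun ξ η => by
    simp [dotProduct, Fin.sum_univ_succ]
  have hdot' : ∀ ξ η : Fin n → ℝ, horizontal n ξ ⬝ᵥ horizontal n η = ξ ⬝ᵥ η := fun ξ η => by
    simp [dotProduct, Fin.sum_univ_succ]
  have hνν : ∀ p : Fin n → ℝ, (Fin.cons (-1) p : Fin (n + 1) → ℝ) ⬝ᵥ Fin.cons (-1) p =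
      1 + p ⬝ᵥ p := fun p => by simp [dotProduct, Fin.sum_univ_succ]
  have hpp : ∀ p : Fin n → ℝ, 0 ≤ p ⬝ᵥ p := fun p => Finset.sum_nonneg fun i _ => mul_self_nonneg _
  refine ⟨c / 2, by positivity, max 1 (3 * C), le_max_left _ _, ?_⟩
  have hCC : C ≤ max 1 (3 * C) := le_trans (by linarith) (le_max_right _ _)
  refine ⟨hF.contDiff_graphForm, fun p ξ η => hF.anisoForm_symm (hν0 p) _ _,
    fun p ξ => hF.anisoForm_nonneg (hν0 p) _, fun p ξ η => ?_, fun p ξ => ?_, fun p ξ hp => ?_,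
    fun p z ξ η => ?_, fun p z ξ η => ?_, fun p z => ?_, fun ε hε => ?_⟩
  · have h := hbA p (horizontal n ξ) (horizontal n η)
    simp only [norm_horizontal] at h
    exact h.trans (by gcongr)
  · rw [graphForm_apply, hradial]
    have h := hbA p e (horizontal n ξ)
    simp only [norm_horizontal, hne, mul_one] at h
    exact h.trans (by gcongr)
  · have h := hcoer (Fin.cons (-1) p) (horizontal n ξ) (hν0 p)
    rw [hdot, hdot', hνν] at h
    refine le_trans ?_ h
    have hp0 : 0 < p ⬝ᵥ p :=
      lt_of_le_of_ne (hpp p) fun h => hp (dotProduct_self_eq_zero.1 h.symm)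
    have hCS : 0 ≤ ξ ⬝ᵥ ξ - (ξ ⬝ᵥ p) ^ 2 / (p ⬝ᵥ p) := by
      have := Finset.sum_mul_sq_le_sq_mul_sq Finset.univ ξ p
      rw [sub_nonneg, div_le_iff₀ hp0]
      simpa [dotProduct, pow_two] using this
    have h2 : (ξ ⬝ᵥ p) ^ 2 / (1 + p ⬝ᵥ p) ≤ (ξ ⬝ᵥ p) ^ 2 / (p ⬝ᵥ p) := by
      gcongr
      linarith
    calc c / 2 * (ξ ⬝ᵥ ξ - (ξ ⬝ᵥ p) ^ 2 / (p ⬝ᵥ p))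
        ≤ c * (ξ ⬝ᵥ ξ - (ξ ⬝ᵥ p) ^ 2 / (p ⬝ᵥ p)) := by
          refine mul_le_mul_of_nonneg_right (by linarith) hCS
      _ ≤ _ := by gcongr
  · rw [hF.fderiv_graphForm_apply, hF.fderiv_graphForm_apply, hF.fderiv_anisoForm_symm (hν0 p)]
  · rw [hF.fderiv_graphForm_apply]
    have h := hbD p (horizontal n z) (horizontal n ξ) (horizontal n η)
    simp only [norm_horizontal] at h
    calc _ ≤ ‖(Fin.cons (-1) p : Fin (n + 1) → ℝ)‖ * _ :=
          mul_le_mul_of_nonneg_right (norm_le_norm_cons_neg_one p) (abs_nonneg _)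
      _ ≤ _ := h
      _ ≤ _ := by gcongr
  · rw [hF.fderiv_graphForm_apply, hDradial]
    have h1 := hbD p (horizontal n z) e e
    have h2 := hbA p (horizontal n z) e
    simp only [norm_horizontal, hne, mul_one] at h1 h2
    have h3 : |fderiv ℝ (anisoForm F) (Fin.cons (-1) p) (horizontal n z) e e| ≤ C * ‖z‖ :=
      le_trans (le_mul_of_one_le_left (abs_nonneg _) (one_le_norm_cons_neg_one p)) h1
    calc _ ≤ _ := abs_sub _ _
      _ ≤ 3 * C * ‖z‖ := by
        rw [abs_mul, abs_two]
        linarith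
      _ ≤ _ := by
        gcongr
        exact le_max_right _ _
  · obtain ⟨δ, hδ0, hδ⟩ := hF.fderiv_anisoForm_near_equator hsym hε
    refine ⟨max 1 δ⁻¹, le_max_left _ _, fun p hp => ?_⟩
    have hp1 : 1 ≤ ‖p‖ := (le_max_left _ _).trans hp
    have hpδ : 1 ≤ δ * ‖p‖ := by
      have := (le_max_right _ _).trans hp
      rwa [inv_le_iff_one_le_mul₀' hδ0] at this
    have hpν := norm_le_norm_cons_neg_one p
    obtain ⟨h1, h2⟩ := hδ (Fin.cons (-1) p) (hν0 p) (by
      simp only [Fin.cons_zero, abs_neg, abs_one]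
      nlinarith)
    refine ⟨?_, fun ξ η => ?_, ?_⟩
    · have h := hcoer (Fin.cons (-1) p) e (hν0 p)
      rw [hradial']
      refine le_trans ?_ h
      have hee : e ⬝ᵥ e = 1 := by simp [he]
      have heν : e ⬝ᵥ (Fin.cons (-1) p) = -1 := by simp [he]
      have hs : 1 ≤ p ⬝ᵥ p := by
        by_contra! hlt
        have : ‖p‖ < 1 := by
          rw [pi_norm_lt_iff one_pos]
          intro i
          have h3 : p i * p i ≤ p ⬝ᵥ p :=
            Finset.single_le_sum (f := fun i => p i * p i) (fun i _ => mul_self_nonneg _)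
              (Finset.mem_univ i)
          rw [Real.norm_eq_abs, abs_lt]
          constructor <;> nlinarith
        linarith
      rw [hee, heν, hνν, div_eq_mul_one_div]
      gcongr
      have : (-1 : ℝ) ^ 2 / (1 + p ⬝ᵥ p) ≤ 1 / 2 := by
        rw [div_le_div_iff₀ (by linarith) two_pos]
        linarith
      linarith
    · rw [hF.fderiv_graphForm_apply, hDself]
      exact (mul_le_mul_of_nonneg_right hpν (abs_nonneg _)).trans (h1 ξ η)
    · rw [hF.fderiv_graphForm_apply, hDradial, hradial', hradial, hDself, sub_add_cancel]
      exact le_trans (le_mul_of_one_le_left (abs_nonneg _) (one_le_norm_cons_neg_one p)) h2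

end IsAreaIntegrand

section Algebra
variable {n : ℕ}

lemma clm_apply_eq_sum (B : (Fin n → ℝ) →L[ℝ] ℝ) (ξ : Fin n → ℝ) :
    B ξ = ∑ j, B (Pi.single j 1) * ξ j := by
  conv_lhs => rw [← Finset.univ_sum_single ξ, map_sum]
  refine Finset.sum_congr rfl fun j _ => ?_
  have : (Pi.single j (ξ j) : Fin n → ℝ) = ξ j • Pi.single j 1 := by
    rw [← Pi.single_smul, smul_eq_mul, mul_one]
  rw [this, map_smul, smul_eq_mul, mul_comm]

lemma clm_apply_apply_eq_sum (B : (Fin n → ℝ) →L[ℝ] (Fin n → ℝ) →L[ℝ] ℝ) (ξ η : Fin n → ℝ) :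
    B ξ η = ∑ k, ξ k * B (Pi.single k 1) η := by
  rw [← ContinuousLinearMap.flip_apply, clm_apply_eq_sum]
  simp [mul_comm]

/-- Lower bound for `tr(U A U) / |p|² + b tr(B U)` when `U p` is prescribed: the part of `U`
transverse to `p` is absorbed by coercivity. -/
lemma trace_lower_bound {A B : (Fin n → ℝ) →L[ℝ] (Fin n → ℝ) →L[ℝ] ℝ} {c μ b : ℝ} (hc : 0 < c)
    {p w : Fin n → ℝ} {U : Fin n → Fin n → ℝ} (hp : 0 < p ⬝ᵥ p)
    (hA : ∀ ξ η, A ξ η = A η ξ)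
    (hcoer : ∀ ξ, c * (ξ ⬝ᵥ ξ - (ξ ⬝ᵥ p) ^ 2 / (p ⬝ᵥ p)) ≤ A ξ ξ)
    (hB : ∀ ξ η, B ξ η = B η ξ) (hBμ : ∀ i j, |B (Pi.single i 1) (Pi.single j 1)| ≤ μ)
    (hU : ∀ i j, U i j = U j i) (hw : ∑ k, p k • U k = w) :
    A w w / (p ⬝ᵥ p) ^ 2 + b * (2 * B p w / (p ⬝ᵥ p) - (p ⬝ᵥ w) * B p p / (p ⬝ᵥ p) ^ 2)
        - b ^ 2 * (p ⬝ᵥ p) * n ^ 2 * μ ^ 2 / (4 * c) ≤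
      (∑ k, A (U k) (U k)) / (p ⬝ᵥ p) + b * ∑ k, B (Pi.single k 1) (U k) := by
  set s := p ⬝ᵥ p with hs
  have hUp : ∀ k, U k ⬝ᵥ p = w k := fun k => by
    rw [← hw]
    simp [dotProduct, Finset.sum_apply, hU k, mul_comm]
  set z : Fin n → Fin n → ℝ := fun k => U k - (p k / s) • w with hz
  set Y : Fin n → Fin n → ℝ := fun k => z k - ((z k ⬝ᵥ p) / s) • p with hY
  have hpp : ∑ k, p k * p k = s := rfl
  have hAz : ∑ k, A (U k) (U k) = ∑ k, A (z k) (z k) + A w w / s := by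
    have h1 : ∀ k, A (z k) (z k) = A (U k) (U k) - 2 / s * (p k * A (U k) w)
        + (p k * p k) * (A w w / s ^ 2) := fun k => by
      simp only [hz, map_sub, map_smul, sub_apply, smul_apply, smul_eq_mul, hA w (U k)]
      field_simp
      ring
    have h2 : ∑ k, p k * A (U k) w = A w w := by
      calc ∑ k, p k * A (U k) w = A (∑ k, p k • U k) w := by simp [map_sum, sum_apply]
        _ = A w w := by rw [hw]
    simp only [h1, Finset.sum_add_distrib, Finset.sum_sub_distrib, ← Finset.mul_sum,
      ← Finset.sum_mul, h2, hpp]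
    field_simp
    ring
  have hAY : ∀ k, c * ∑ j, Y k j ^ 2 ≤ A (z k) (z k) := fun k => by
    refine le_trans (le_of_eq ?_) (hcoer (z k))
    have : ∑ j, Y k j ^ 2 = Y k ⬝ᵥ Y k := by simp [dotProduct, pow_two]
    rw [this, hY]
    simp only [sub_dotProduct, dotProduct_sub, smul_dotProduct, dotProduct_smul, smul_eq_mul,
      dotProduct_comm p (z k), ← hs]
    field_simp
    ring
  have hBY : ∑ k, B (Pi.single k 1) (U k) =
      ∑ k, B (Pi.single k 1) (Y k) + 2 * B p w / s - (p ⬝ᵥ w) * B p p / s ^ 2 := by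
    have h1 : ∀ k, B (Pi.single k 1) (Y k) = B (Pi.single k 1) (U k)
        - 1 / s * (p k * B (Pi.single k 1) w)
        - 1 / s * (w k * B (Pi.single k 1) p)
        + ((p ⬝ᵥ w) / s ^ 2) * (p k * B (Pi.single k 1) p) := fun k => by
      simp only [hY, hz, map_sub, map_smul, smul_eq_mul, sub_dotProduct, smul_dotProduct, hUp,
        dotProduct_comm w p]
      field_simp
      ring
    simp only [h1, Finset.sum_add_distrib, Finset.sum_sub_distrib, ← Finset.mul_sum,
      ← clm_apply_apply_eq_sum, hB w p]
    ring
  have hquad : ∀ k, -(b ^ 2 * s * n * μ ^ 2 / (4 * c)) ≤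
      c * (∑ j, Y k j ^ 2) / s + b * B (Pi.single k 1) (Y k) := fun k => by
    rw [clm_apply_eq_sum, Finset.mul_sum, Finset.mul_sum, Finset.sum_div, ← Finset.sum_add_distrib]
    have h1 : ∀ j ∈ Finset.univ, -(b ^ 2 * s * μ ^ 2 / (4 * c)) ≤ c * Y k j ^ 2 / s +
        b * (B (Pi.single k 1) (Pi.single j 1) * Y k j) := fun j _ => by
      have h2 : (B (Pi.single k 1) (Pi.single j 1)) ^ 2 ≤ μ ^ 2 := by
        rw [← sq_abs]
        exact pow_le_pow_left₀ (abs_nonneg _) (hBμ k j) 2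
      set β := B (Pi.single k 1) (Pi.single j 1)
      have h3 : c * Y k j ^ 2 / s + b * (β * Y k j) + b ^ 2 * s * β ^ 2 / (4 * c) =
          (2 * c * Y k j + b * s * β) ^ 2 / (4 * c * s) := by
        field_simp
        ring
      have h4 : 0 ≤ (2 * c * Y k j + b * s * β) ^ 2 / (4 * c * s) := by positivity
      have h5 : b ^ 2 * s * β ^ 2 / (4 * c) ≤ b ^ 2 * s * μ ^ 2 / (4 * c) := by gcongr
      linarith
    have h6 := Finset.card_nsmul_le_sum _ _ _ h1
    refine le_trans (le_of_eq ?_) h6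
    simp
    ring
  have hsum := Finset.sum_le_sum fun k (_ : k ∈ Finset.univ) => hquad k
  rw [Finset.sum_add_distrib, ← Finset.sum_div, ← Finset.mul_sum, ← Finset.mul_sum] at hsum
  simp only [Finset.sum_const, Finset.card_univ, Fintype.card_fin, nsmul_eq_mul] at hsum
  have hAY' : (c * ∑ k, ∑ j, Y k j ^ 2) / s ≤ (∑ k, A (z k) (z k)) / s := by
    rw [Finset.mul_sum]
    gcongr with k
    exact hAY k
  rw [hAz, hBY, add_div, div_div, ← pow_two]
  have e1 : b ^ 2 * s * n ^ 2 * μ ^ 2 / (4 * c) = n * (b ^ 2 * s * n * μ ^ 2 / (4 * c)) := by ring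
  rw [e1]
  linarith

end Algebra

namespace IsAsymptoticallyEven
variable {n : ℕ} {a : (Fin n → ℝ) → (Fin n → ℝ) →L[ℝ] (Fin n → ℝ) →L[ℝ] ℝ} {c C : ℝ}

set_option maxHeartbeats 1000000 in
/-- The algebraic core of the gradient estimate. -/
lemma exists_trace_estimate (H : IsAsymptoticallyEven a c C) (hc : 0 < c) (hC : 1 ≤ C) :
    ∃ τ > 0, ∃ P ≥ 1, ∀ p, P ≤ ‖p‖ → ∀ η, ‖η‖ ≤ τ → ∀ (b : ℝ) (U : Fin n → Fin n → ℝ),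
      (∀ i j, U i j = U j i) → ∑ k, p k • U k = -((p ⬝ᵥ p) * b) • (p - η) →
      5 / 2 * b ^ 2 * a p (p - η) (p - η) - (∑ k, a p (U k) (U k)) / (p ⬝ᵥ p) -
        b * ∑ k, fderiv ℝ a p (p - η) (Pi.single k 1) (U k) ≤ -(c / 4) * b ^ 2 := by
  set K := 12 * C + 2 * n * C + n ^ 3 * (1 + C) ^ 2 / (4 * c) with hK
  have hK0 : 0 < K := by positivity
  set τ := min 1 (c / (4 * K)) with hτ
  have hτ0 : 0 < τ := by positivity
  have hτ1 : τ ≤ 1 := min_le_left _ _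
  have hτK : τ * K ≤ c / 4 := by
    have : τ ≤ c / (4 * K) := min_le_right _ _
    rw [le_div_iff₀ (by positivity)] at this
    linarith
  obtain ⟨P, hP, hasy⟩ := H.asymptotic τ hτ0
  refine ⟨τ, hτ0, P, hP, fun p hp η hη b U hU hw => ?_⟩
  obtain ⟨h1, h2, h3⟩ := hasy p hp
  have hp1 : 1 ≤ ‖p‖ := hP.trans hp
  have hp0 : p ≠ 0 := by
    rintro rfl
    simp at hp1
    linarith
  have hss : ‖p‖ ^ 2 ≤ p ⬝ᵥ p := by
    have h4 : ‖p‖ ≤ √(p ⬝ᵥ p) := by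
      refine (pi_norm_le_iff_of_nonneg (Real.sqrt_nonneg _)).2 fun i => ?_
      rw [Real.norm_eq_abs]
      refine Real.abs_le_sqrt ?_
      rw [pow_two]
      exact Finset.single_le_sum (f := fun i => p i * p i) (fun i _ => mul_self_nonneg _)
        (Finset.mem_univ i)
    exact (pow_le_pow_left₀ (norm_nonneg _) h4 2).trans_eq
      (Real.sq_sqrt (Finset.sum_nonneg fun i _ => mul_self_nonneg _))
  have hs0 : 0 < p ⬝ᵥ p := by nlinarith
  have hdot : ∀ ξ η : Fin n → ℝ, |ξ ⬝ᵥ η| ≤ n * (‖ξ‖ * ‖η‖) := fun ξ η => by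
    refine (Finset.abs_sum_le_sum_abs _ _).trans ?_
    have := Finset.sum_le_card_nsmul Finset.univ (fun i => |ξ i * η i|) (‖ξ‖ * ‖η‖) (fun i _ => by
      rw [abs_mul]
      exact mul_le_mul (norm_le_pi_norm ξ i) (norm_le_pi_norm η i) (abs_nonneg _) (norm_nonneg _))
    simpa using this
  have hsn : p ⬝ᵥ p ≤ n * ‖p‖ ^ 2 := by
    rw [pow_two]
    exact (le_abs_self _).trans (hdot p p)
  set s := p ⬝ᵥ p with hs
  set σ := p - η with hσ
  set D := fderiv ℝ a p with hD
  have hDσ : ∀ ξ ζ, D σ ξ ζ = D p ξ ζ - D η ξ ζ := fun ξ ζ => by simp [hσ]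
  have hDη : ∀ ξ ζ, ‖p‖ * |D η ξ ζ| ≤ C * τ * ‖ξ‖ * ‖ζ‖ := fun ξ ζ =>
    (H.fderiv_bound p η ξ ζ).trans (by gcongr)
  set μ := τ * (1 + C) / ‖p‖ with hμ
  have hBμ : ∀ i j, |D σ (Pi.single i 1) (Pi.single j 1)| ≤ μ := fun i j => by
    rw [hμ, le_div_iff₀ (by linarith), hDσ]
    have h4 := h2 (Pi.single i 1) (Pi.single j 1)
    have h5 := hDη (Pi.single i 1) (Pi.single j 1)
    simp only [Pi.norm_single, norm_one, mul_one] at h4 h5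
    have h6 := mul_le_mul_of_nonneg_left
      (abs_sub (D p (Pi.single i 1) (Pi.single j 1)) (D η (Pi.single i 1) (Pi.single j 1)))
      (norm_nonneg p)
    linarith
  have key := trace_lower_bound (b := b) hc hs0 (H.symm p) (fun ξ => H.coercive p ξ hp0)
    (H.fderiv_symm p σ) hBμ hU hw
  have e1 : a p (-(s * b) • σ) (-(s * b) • σ) / s ^ 2 = b ^ 2 * a p σ σ := by
    simp only [map_smul, smul_apply, smul_eq_mul]
    field_simp
  have e2 : b * (2 * D σ p (-(s * b) • σ) / s - (p ⬝ᵥ (-(s * b) • σ)) * D σ p p / s ^ 2) =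
      b ^ 2 * (-2 * D σ p σ + (p ⬝ᵥ σ) / s * D σ p p) := by
    simp only [map_smul, smul_eq_mul, dotProduct_smul]
    field_simp
    ring
  have e3 : D σ p σ = D σ p p - D σ p η := by rw [← map_sub]
  have e4 : (p ⬝ᵥ σ) / s * D σ p p = D σ p p - (p ⬝ᵥ η) / s * D σ p p := by
    rw [hσ, dotProduct_sub, ← hs]
    field_simp
  have e5 : a p σ σ = a p p p - 2 * a p p η + a p η η := by
    simp only [hσ, map_sub, sub_apply, H.symm p η p]
    ring
  have b1 : |a p p η| ≤ C * τ := (H.bound_radial p η).trans (by gcongr)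
  have b2 : a p η η ≤ C * τ := by
    refine (le_abs_self _).trans ((H.bound p η η).trans ?_)
    calc C * ‖η‖ * ‖η‖ ≤ C * τ * 1 := by gcongr; exact hη.trans hτ1
      _ = C * τ := mul_one _
  have b3 : |D η p p| ≤ C * τ := (H.fderiv_bound_radial p η).trans (by gcongr)
  have b4 : |D p p p| ≤ C * ‖p‖ := H.fderiv_bound_radial p p
  have b5 : |D p p η| ≤ τ := by
    have h4 := h2 p η
    have h5 : ‖p‖ * |D p p η| ≤ ‖p‖ * τ := h4.trans (by
      calc τ * ‖p‖ * ‖η‖ ≤ 1 * ‖p‖ * τ := by gcongr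
        _ = _ := by ring)
    exact le_of_mul_le_mul_left h5 (by linarith)
  have b6 : |D η p η| ≤ C * τ := by
    have h4 := hDη p η
    have h5 : ‖p‖ * |D η p η| ≤ ‖p‖ * (C * τ) := h4.trans (by
      calc C * τ * ‖p‖ * ‖η‖ ≤ C * τ * ‖p‖ * 1 := by gcongr; exact hη.trans hτ1
        _ = _ := by ring)
    exact le_of_mul_le_mul_left h5 (by linarith)
  have b7 : |(p ⬝ᵥ η) / s * D σ p p| ≤ 2 * n * C * τ := by
    have h4 : |D σ p p| ≤ 2 * C * ‖p‖ := by
      rw [hDσ]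
      have h5 := abs_sub (D p p p) (D η p p)
      have h6 : C * τ ≤ C * ‖p‖ := by
        gcongr
        linarith
      linarith
    rw [abs_mul, abs_div, abs_of_pos hs0, div_mul_eq_mul_div, div_le_iff₀ hs0]
    calc |p ⬝ᵥ η| * |D σ p p| ≤ (n * (‖p‖ * ‖η‖)) * (2 * C * ‖p‖) := by
          gcongr
          exact hdot p η
      _ ≤ (n * (‖p‖ * τ)) * (2 * C * ‖p‖) := by gcongr
      _ = 2 * n * C * τ * ‖p‖ ^ 2 := by ring
      _ ≤ _ := by gcongr
  have b8 : s * n ^ 2 * μ ^ 2 / (4 * c) ≤ τ * (n ^ 3 * (1 + C) ^ 2 / (4 * c)) := by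
    rw [mul_div_assoc']
    refine div_le_div_of_nonneg_right ?_ (by positivity)
    calc s * n ^ 2 * μ ^ 2 ≤ (n * ‖p‖ ^ 2) * n ^ 2 * μ ^ 2 := by gcongr
      _ = τ ^ 2 * (n ^ 3 * (1 + C) ^ 2) := by
        rw [hμ]
        field_simp
      _ ≤ τ * (n ^ 3 * (1 + C) ^ 2) := by
        gcongr
        nlinarith
  rw [e1, e2, e4, e3] at key
  have hbr : 3 / 2 * a p σ σ + (2 * (D σ p p - D σ p η)) - (D σ p p - (p ⬝ᵥ η) / s * D σ p p) +
      s * n ^ 2 * μ ^ 2 / (4 * c) ≤ -(c / 4) := by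
    rw [e5]
    have h4 := hDσ p p
    have h5 := hDσ p η
    have hτC : τ ≤ C * τ := by nlinarith
    rw [abs_le] at b1 b3 b5 b6 b7 h3
    nlinarith
  have := mul_le_mul_of_nonneg_left hbr (sq_nonneg b)
  have e6 : b ^ 2 * s * n ^ 2 * μ ^ 2 / (4 * c) = b ^ 2 * (s * n ^ 2 * μ ^ 2 / (4 * c)) := by ring
  rw [e6] at key
  linarith

end IsAsymptoticallyEven

/-- A nonnegative symmetric bilinear form is a sum of squares of linear forms. -/
lemma exists_sum_mul_eq_of_nonneg {n : ℕ} {B : (Fin n → ℝ) →L[ℝ] (Fin n → ℝ) →L[ℝ] ℝ}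
    (hB : ∀ ξ η, B ξ η = B η ξ) (h0 : ∀ ξ, 0 ≤ B ξ ξ) :
    ∃ X : Fin n → Fin n → ℝ, ∀ i j,
      B (Pi.single i 1) (Pi.single j 1) = ∑ l, X l i * X l j := by
  set A : Matrix (Fin n) (Fin n) ℝ := Matrix.of fun i j => B (Pi.single i 1) (Pi.single j 1)
  have hA : A.PosSemidef := by
    refine Matrix.PosSemidef.of_dotProduct_mulVec_nonneg ?_ fun ξ => ?_
    · ext i j
      simp [A, hB (Pi.single i 1)]
    · refine (h0 ξ).trans_eq ?_
      rw [clm_apply_apply_eq_sum B ξ ξ]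
      simp only [dotProduct, Matrix.mulVec, star_trivial]
      refine Finset.sum_congr rfl fun i _ => ?_
      rw [clm_apply_eq_sum]
      rfl
  open scoped MatrixOrder in
  obtain ⟨X, hX⟩ := CStarAlgebra.nonneg_iff_eq_star_mul_self.1 hA.nonneg
  refine ⟨X, fun i j => ?_⟩
  have := congrFun (congrFun hX i) j
  simpa [A, Matrix.mul_apply, Matrix.star_eq_conjTranspose] using this

section Derivatives
variable {E : Type*} [NormedAddCommGroup E] [NormedSpace ℝ E] {f : E → ℝ} {z : E}

lemma ContDiffAt.fderiv_apply_const {m k : WithTop ℕ∞} (hf : ContDiffAt ℝ k f z) (h : m + 1 ≤ k)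
    (w : E) : ContDiffAt ℝ m (fun z => fderiv ℝ f z w) z :=
  (hf.fderiv_right h).clm_apply contDiffAt_const

lemma ContDiffAt.fderiv_fderiv_apply_const (hf : ContDiffAt ℝ 2 f z) (v w : E) :
    fderiv ℝ (fun z => fderiv ℝ f z w) z v = fderiv ℝ (fderiv ℝ f) z v w := by
  have h : DifferentiableAt ℝ (fderiv ℝ f) z :=
    (hf.fderiv_right (m := 1) (by norm_num)).differentiableAt (by norm_num)
  rw [fderiv_clm_apply h (differentiableAt_const w)]
  simp

lemma ContDiffAt.fderiv_fderiv_comm (hf : ContDiffAt ℝ 2 f z) (v w : E) :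
    fderiv ℝ (fun z => fderiv ℝ f z w) z v = fderiv ℝ (fun z => fderiv ℝ f z v) z w := by
  rw [hf.fderiv_fderiv_apply_const, hf.fderiv_fderiv_apply_const,
    (hf.isSymmSndFDerivAt (by norm_num)).eq v w]

lemma hasDerivAt_comp_line {w : E} {h : ℝ} (hf : DifferentiableAt ℝ f (z + h • w)) :
    HasDerivAt (fun h : ℝ => f (z + h • w)) (fderiv ℝ f (z + h • w) w) h := by
  have h1 : HasDerivAt (fun h : ℝ => z + h • w) w h := by
    simpa using ((hasDerivAt_id h).smul_const w).const_add z
  exact hf.hasFDerivAt.comp_hasDerivAt h h1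

lemma tendsto_line (w : E) : Tendsto (fun h : ℝ => z + h • w) (nhds 0) (nhds z) := by
  have : Continuous (fun h : ℝ => z + h • w) := by fun_prop
  simpa using this.tendsto 0

lemma fderiv_eq_zero_of_isLocalMax_line (hf : DifferentiableAt ℝ f z) {w : E}
    (hmax : IsLocalMax (fun h : ℝ => f (z + h • w)) 0) : fderiv ℝ f z w = 0 := by
  have h := hasDerivAt_comp_line (z := z) (w := w) (h := 0) (by simpa using hf)
  simpa using hmax.hasDerivAt_eq_zero h

lemma fderiv_fderiv_nonpos_of_isLocalMax_line (hf : ContDiffAt ℝ 2 f z) {w : E}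
    (hmax : IsLocalMax (fun h : ℝ => f (z + h • w)) 0) : fderiv ℝ (fderiv ℝ f) z w w ≤ 0 := by
  set φ : ℝ → ℝ := fun h => f (z + h • w)
  have h1 : deriv φ =ᶠ[nhds 0] fun h => fderiv ℝ f (z + h • w) w := by
    have : ∀ᶠ z' in nhds z, ContDiffAt ℝ 2 f z' := hf.eventually (by simp)
    filter_upwards [(tendsto_line w).eventually this] with h hh
    exact (hasDerivAt_comp_line (hh.differentiableAt (by norm_num))).deriv
  have h2 : deriv (deriv φ) 0 = fderiv ℝ (fderiv ℝ f) z w w := by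
    rw [h1.deriv_eq, ← hf.fderiv_fderiv_apply_const]
    have hd : DifferentiableAt ℝ (fun z => fderiv ℝ f z w) (z + (0 : ℝ) • w) := by
      simpa using (hf.fderiv_apply_const (m := 1) (by norm_num) w).differentiableAt one_ne_zero
    simpa using (hasDerivAt_comp_line hd).deriv
  by_contra! hpos
  rw [← h2] at hpos
  have hφ0 : deriv φ 0 = 0 := hmax.deriv_eq_zero
  have hcont : ContinuousAt φ 0 :=
    (hasDerivAt_comp_line (by simpa using hf.differentiableAt (by norm_num))).continuousAt
  have hmin := isLocalMin_of_deriv_deriv_pos hpos hφ0 hcont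
  have hconst : φ =ᶠ[nhds 0] fun _ => φ 0 := by
    filter_upwards [hmax, hmin] with h ha hb using le_antisymm ha hb
  have : deriv (deriv φ) 0 = 0 := by
    rw [hconst.deriv.deriv_eq]
    simp
  linarith

lemma fderiv_nonneg_of_left_max (hf : DifferentiableAt ℝ f z) {w : E}
    (hmax : ∀ᶠ h : ℝ in nhdsWithin 0 (Iic 0), f (z + h • w) ≤ f z) : 0 ≤ fderiv ℝ f z w := by
  have h := hasDerivAt_comp_line (z := z) (w := w) (h := 0) (by simpa using hf)
  simp only [zero_smul, add_zero] at h
  have h2 := (hasDerivAt_iff_tendsto_slope_zero.1 h).mono_left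
    (nhdsWithin_mono (0 : ℝ) (fun x (hx : x ∈ Iio 0) => ne_of_lt hx))
  refine ge_of_tendsto h2 ?_
  filter_upwards [nhdsWithin_mono 0 Iio_subset_Iic_self hmax, self_mem_nhdsWithin] with h h3 h4
  simp only [zero_add, zero_smul, add_zero, smul_eq_mul]
  exact mul_nonneg_of_nonpos_of_nonpos (inv_nonpos.2 (le_of_lt h4)) (by linarith)

end Derivatives

/-- At a spatial maximum, the contraction of the Hessian with a nonnegative form is nonpositive. -/
lemma sum_fderiv_fderiv_nonpos {n : ℕ} {ψ : (Fin n → ℝ) × ℝ → ℝ} {z : (Fin n → ℝ) × ℝ}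
    (hψ : ContDiffAt ℝ 2 ψ z)
    (hmax : ∀ ξ : Fin n → ℝ, IsLocalMax (fun h : ℝ => ψ (z + h • (ξ, (0 : ℝ)))) 0)
    {B : (Fin n → ℝ) →L[ℝ] (Fin n → ℝ) →L[ℝ] ℝ}
    (hB : ∀ ξ η, B ξ η = B η ξ) (h0 : ∀ ξ, 0 ≤ B ξ ξ) :
    ∑ i, ∑ j, B (Pi.single i 1) (Pi.single j 1) *
      fderiv ℝ (fun z => fderiv ℝ ψ z (Pi.single j 1, 0)) z (Pi.single i 1, 0) ≤ 0 := by
  obtain ⟨X, hX⟩ := exists_sum_mul_eq_of_nonneg hB h0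
  set L := fderiv ℝ (fderiv ℝ ψ) z
  set H := L.bilinearComp (ContinuousLinearMap.inl ℝ (Fin n → ℝ) ℝ)
    (ContinuousLinearMap.inl ℝ (Fin n → ℝ) ℝ) with hH
  have h1 : ∀ ξ, H ξ ξ ≤ 0 := fun ξ => fderiv_fderiv_nonpos_of_isLocalMax_line hψ (hmax ξ)
  have h2 : ∀ l, H (X l) (X l) = ∑ i, ∑ j, X l i * X l j * H (Pi.single i 1) (Pi.single j 1) := by
    intro l
    rw [clm_apply_apply_eq_sum]
    refine Finset.sum_congr rfl fun i _ => ?_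
    rw [clm_apply_eq_sum, Finset.mul_sum]
    exact Finset.sum_congr rfl fun j _ => by ring
  have h3 : ∑ i, ∑ j, B (Pi.single i 1) (Pi.single j 1) *
      fderiv ℝ (fun z => fderiv ℝ ψ z (Pi.single j 1, 0)) z (Pi.single i 1, 0) =
      ∑ l, H (X l) (X l) := by
    simp only [h2, hX, hψ.fderiv_fderiv_apply_const]
    rw [Finset.sum_comm' (t' := Finset.univ) (s' := fun _ => Finset.univ) (by simp)]
    conv_rhs => rw [Finset.sum_comm]; enter [2, i]; rw [Finset.sum_comm]
    rw [Finset.sum_comm]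
    refine Finset.sum_congr rfl fun i _ => Finset.sum_congr rfl fun j _ => ?_
    rw [Finset.sum_mul]
    rfl
  rw [h3]
  exact Finset.sum_nonpos fun l _ => h1 _

section LogDerivatives
variable {E : Type*} [NormedAddCommGroup E] [NormedSpace ℝ E] {g : E → ℝ} {z : E}

lemma fderiv_log_apply (hg : DifferentiableAt ℝ g z) (h0 : g z ≠ 0) (v : E) :
    fderiv ℝ (fun z => Real.log (g z)) z v = fderiv ℝ g z v / g z := by
  rw [(hg.hasFDerivAt.log h0).fderiv]
  simp [div_eq_inv_mul]

lemma fderiv_fderiv_log_apply (hg : ContDiffAt ℝ 2 g z) (h0 : g z ≠ 0) (v w : E) :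
    fderiv ℝ (fun z => fderiv ℝ (fun z => Real.log (g z)) z v) z w =
      fderiv ℝ (fun z => fderiv ℝ g z v) z w / g z -
        fderiv ℝ g z v * fderiv ℝ g z w / g z ^ 2 := by
  have h1 : (fun z => fderiv ℝ (fun z => Real.log (g z)) z v) =ᶠ[nhds z]
      fun z => fderiv ℝ g z v / g z := by
    filter_upwards [hg.eventually (by simp), hg.continuousAt.eventually_ne h0] with z' hz' h0'
    exact fderiv_log_apply (hz'.differentiableAt (by norm_num)) h0' v
  rw [h1.fderiv_eq]
  have hv : DifferentiableAt ℝ (fun z => fderiv ℝ g z v) z :=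
    (hg.fderiv_apply_const (m := 1) (by norm_num) v).differentiableAt one_ne_zero
  have hd : DifferentiableAt ℝ g z := hg.differentiableAt (by norm_num)
  have hi : HasFDerivAt (fun z => (g z)⁻¹) (-(g z ^ 2)⁻¹ • fderiv ℝ g z) z :=
    (hasDerivAt_inv h0).comp_hasFDerivAt z hd.hasFDerivAt
  simp only [div_eq_mul_inv]
  rw [(hv.hasFDerivAt.fun_mul hi).fderiv]
  simp only [smul_apply, add_apply, smul_eq_mul]
  field_simp
  ring

lemma fderiv_sum_sq_apply {ι : Type*} [Fintype ι] {p : E → ι → ℝ}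
    (hp : ∀ k, DifferentiableAt ℝ (fun z => p z k) z) (v : E) :
    fderiv ℝ (fun z => p z ⬝ᵥ p z) z v = 2 * ∑ k, p z k * fderiv ℝ (fun z => p z k) z v := by
  simp only [dotProduct]
  rw [fderiv_fun_sum fun k _ => (hp k).fun_mul (hp k), sum_apply, Finset.mul_sum]
  refine Finset.sum_congr rfl fun k _ => ?_
  rw [fderiv_fun_mul (hp k) (hp k)]
  simp only [smul_apply, add_apply, smul_eq_mul]
  ring

lemma fderiv_fderiv_sum_sq_apply {ι : Type*} [Fintype ι] {p : E → ι → ℝ}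
    (hp : ∀ k, ContDiffAt ℝ 2 (fun z => p z k) z) (v w : E) :
    fderiv ℝ (fun z => fderiv ℝ (fun z => p z ⬝ᵥ p z) z v) z w =
      2 * ∑ k, (fderiv ℝ (fun z => p z k) z w * fderiv ℝ (fun z => p z k) z v +
        p z k * fderiv ℝ (fun z => fderiv ℝ (fun z => p z k) z v) z w) := by
  have h1 : (fun z => fderiv ℝ (fun z => p z ⬝ᵥ p z) z v) =ᶠ[nhds z]
      fun z => 2 * ∑ k, p z k * fderiv ℝ (fun z => p z k) z v := by
    have : ∀ᶠ z' in nhds z, ∀ k, ContDiffAt ℝ 2 (fun z => p z k) z' :=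
      eventually_all.2 fun k => (hp k).eventually (by simp)
    filter_upwards [this] with z' hz'
    exact fderiv_sum_sq_apply (fun k => (hz' k).differentiableAt (by norm_num)) v
  have hd : ∀ k, DifferentiableAt ℝ (fun z => p z k) z :=
    fun k => (hp k).differentiableAt (by norm_num)
  have hd' : ∀ k, DifferentiableAt ℝ (fun z => fderiv ℝ (fun z => p z k) z v) z :=
    fun k => ((hp k).fderiv_apply_const (m := 1) (by norm_num) v).differentiableAt one_ne_zero
  rw [h1.fderiv_eq, fderiv_const_mul (.fun_sum fun k _ => (hd k).fun_mul (hd' k)),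
    fderiv_fun_sum fun k _ => (hd k).fun_mul (hd' k), smul_apply, sum_apply, smul_eq_mul]
  congr 1
  refine Finset.sum_congr rfl fun k _ => ?_
  rw [fderiv_fun_mul (hd k) (hd' k)]
  simp only [smul_apply, add_apply, smul_eq_mul]
  ring

end LogDerivatives

section Flow
variable {n : ℕ}

/-- The spatial gradient of a function on space-time. -/
noncomputable def spaceGrad (u : (Fin n → ℝ) × ℝ → ℝ) (z : (Fin n → ℝ) × ℝ) : Fin n → ℝ :=
  fun k => fderiv ℝ u z (Pi.single k 1, 0)

/-- The quasilinear equation `∂ₜu = a(Du)ⁱʲ ∂ᵢ∂ⱼu` at a point of space-time. -/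
def SolvesAt (a : (Fin n → ℝ) → (Fin n → ℝ) →L[ℝ] (Fin n → ℝ) →L[ℝ] ℝ)
    (u : (Fin n → ℝ) × ℝ → ℝ) (z : (Fin n → ℝ) × ℝ) : Prop :=
  fderiv ℝ u z (0, 1) = ∑ i, ∑ j, a (spaceGrad u z) (Pi.single i 1) (Pi.single j 1) *
    fderiv ℝ (fun z => spaceGrad u z j) z (Pi.single i 1, 0)

variable {a : (Fin n → ℝ) → (Fin n → ℝ) →L[ℝ] (Fin n → ℝ) →L[ℝ] ℝ}
  {u : (Fin n → ℝ) × ℝ → ℝ} {z : (Fin n → ℝ) × ℝ}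

lemma contDiffAt_spaceGrad_apply (hu : ContDiffAt ℝ 3 u z) (k : Fin n) :
    ContDiffAt ℝ 2 (fun z => spaceGrad u z k) z :=
  hu.fderiv_apply_const (by norm_num) _

lemma fderiv_spaceGrad_comm (hu : ContDiffAt ℝ 3 u z) (i j : Fin n) :
    fderiv ℝ (fun z => spaceGrad u z i) z (Pi.single j 1, 0) =
      fderiv ℝ (fun z => spaceGrad u z j) z (Pi.single i 1, 0) :=
  (hu.of_le (by norm_num)).fderiv_fderiv_comm _ _

/-- The equation satisfied by the spatial derivatives of a solution. -/
lemma fderiv_spaceGrad_time (ha : ContDiff ℝ 1 a) (hu : ContDiffAt ℝ 3 u z)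
    (hsol : ∀ᶠ z in nhds z, SolvesAt a u z) (k : Fin n) :
    fderiv ℝ (fun z => spaceGrad u z k) z (0, 1) = ∑ i, ∑ j,
      (fderiv ℝ a (spaceGrad u z)
          (fun l => fderiv ℝ (fun z => spaceGrad u z k) z (Pi.single l 1, 0))
          (Pi.single i 1) (Pi.single j 1) *
          fderiv ℝ (fun z => spaceGrad u z j) z (Pi.single i 1, 0) +
        a (spaceGrad u z) (Pi.single i 1) (Pi.single j 1) *
          fderiv ℝ (fun z => fderiv ℝ (fun z => spaceGrad u z k) z (Pi.single j 1, 0)) z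
            (Pi.single i 1, 0)) := by
  have hu2 : ContDiffAt ℝ 2 u z := hu.of_le (by norm_num)
  have hp := contDiffAt_spaceGrad_apply hu
  have h1 : fderiv ℝ (fun z => spaceGrad u z k) z (0, 1) =
      fderiv ℝ (fun z => fderiv ℝ u z (0, 1)) z (Pi.single k 1, 0) :=
    hu2.fderiv_fderiv_comm _ _
  have h2 : (fun z => fderiv ℝ u z (0, 1)) =ᶠ[nhds z] fun z =>
      ∑ i, ∑ j, a (spaceGrad u z) (Pi.single i 1) (Pi.single j 1) *
        fderiv ℝ (fun z => spaceGrad u z j) z (Pi.single i 1, 0) := hsol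
  rw [h1, h2.fderiv_eq]
  have hpd : HasFDerivAt (spaceGrad u)
      (ContinuousLinearMap.pi fun l => fderiv ℝ (fun z => spaceGrad u z l) z) z :=
    hasFDerivAt_pi.2 fun l => ((hp l).differentiableAt (by norm_num)).hasFDerivAt
  have hA : ∀ i j : Fin n, HasFDerivAt
      (fun z => a (spaceGrad u z) (Pi.single i 1) (Pi.single j 1)) _ z := fun i j =>
    ((((ha.differentiable one_ne_zero _).hasFDerivAt.comp z hpd).clm_apply
      (hasFDerivAt_const (Pi.single i 1) z)).clm_apply (hasFDerivAt_const (Pi.single j 1) z))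
  have hU : ∀ i j : Fin n, HasFDerivAt
      (fun z => fderiv ℝ (fun z => spaceGrad u z j) z (Pi.single i 1, 0)) _ z := fun i j =>
    (((hp j).fderiv_apply_const (m := 1) (by norm_num) _).differentiableAt
      one_ne_zero).hasFDerivAt
  have hsum := HasFDerivAt.fun_sum fun i (_ : i ∈ Finset.univ) =>
    HasFDerivAt.fun_sum fun j (_ : j ∈ Finset.univ) => (hA i j).fun_mul (hU i j)
  have hsum' := hsum.fderiv
  rw [hsum', sum_apply]
  refine Finset.sum_congr rfl fun i _ => ?_
  rw [sum_apply]
  refine Finset.sum_congr rfl fun j _ => ?_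
  have h3 : fderiv ℝ (fun z => fderiv ℝ (fun z => spaceGrad u z j) z (Pi.single i 1, 0)) z
      (Pi.single k 1, 0) =
      fderiv ℝ (fun z => fderiv ℝ (fun z => spaceGrad u z k) z (Pi.single j 1, 0)) z
        (Pi.single i 1, 0) := by
    rw [(hp j).fderiv_fderiv_comm]
    refine DFunLike.congr_fun (Filter.EventuallyEq.fderiv_eq ?_) _
    filter_upwards [hu.eventually (by simp)] with z' hz'
    exact fderiv_spaceGrad_comm hz' j k
  have h4 : (ContinuousLinearMap.pi fun l => fderiv ℝ (fun z => spaceGrad u z l) z)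
      ((Pi.single k 1 : Fin n → ℝ), (0 : ℝ)) =
      fun l => fderiv ℝ (fun z => spaceGrad u z k) z (Pi.single l 1, 0) := by
    ext l
    exact fderiv_spaceGrad_comm hu l k
  simp [h3, ← h4]
  ring

end Flow

section SecondDerivatives
variable {E : Type*} [NormedAddCommGroup E] [NormedSpace ℝ E] {f g : E → ℝ} {z : E}

lemma fderiv_fderiv_add_apply (hf : ContDiffAt ℝ 2 f z) (hg : ContDiffAt ℝ 2 g z) (v w : E) :
    fderiv ℝ (fun z => fderiv ℝ (fun z => f z + g z) z v) z w =
      fderiv ℝ (fun z => fderiv ℝ f z v) z w + fderiv ℝ (fun z => fderiv ℝ g z v) z w := by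
  have h1 : (fun z => fderiv ℝ (fun z => f z + g z) z v) =ᶠ[nhds z]
      fun z => fderiv ℝ f z v + fderiv ℝ g z v := by
    filter_upwards [hf.eventually (by simp), hg.eventually (by simp)] with z' h h'
    rw [fderiv_fun_add (h.differentiableAt (by norm_num)) (h'.differentiableAt (by norm_num)),
      add_apply]
  rw [h1.fderiv_eq, fderiv_fun_add, add_apply]
  · exact (hf.fderiv_apply_const (m := 1) (by norm_num) v).differentiableAt one_ne_zero
  · exact (hg.fderiv_apply_const (m := 1) (by norm_num) v).differentiableAt one_ne_zero

lemma fderiv_fderiv_const_mul_apply (hf : ContDiffAt ℝ 2 f z) (r : ℝ) (v w : E) :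
    fderiv ℝ (fun z => fderiv ℝ (fun z => r * f z) z v) z w =
      r * fderiv ℝ (fun z => fderiv ℝ f z v) z w := by
  have h1 : (fun z => fderiv ℝ (fun z => r * f z) z v) =ᶠ[nhds z]
      fun z => r * fderiv ℝ f z v := by
    filter_upwards [hf.eventually (by simp)] with z' h
    rw [fderiv_const_mul (h.differentiableAt (by norm_num)), smul_apply, smul_eq_mul]
  rw [h1.fderiv_eq, fderiv_const_mul, smul_apply, smul_eq_mul]
  exact (hf.fderiv_apply_const (m := 1) (by norm_num) v).differentiableAt one_ne_zero

end SecondDerivatives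

section Barrier
variable {n : ℕ}

/-- The localizing function `-κ |x - x₀|² + l t - m`. -/
noncomputable def barrier (κ l m : ℝ) (x₀ : Fin n → ℝ) (z : (Fin n → ℝ) × ℝ) : ℝ :=
  -κ * ((z.1 - x₀) ⬝ᵥ (z.1 - x₀)) + (l * z.2 - m)

variable {κ l m : ℝ} {x₀ : Fin n → ℝ} {z : (Fin n → ℝ) × ℝ}

lemma contDiff_dist_sq {k : WithTop ℕ∞} : ContDiff ℝ k
    fun z : (Fin n → ℝ) × ℝ => (z.1 - x₀) ⬝ᵥ (z.1 - x₀) := by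
  simp only [dotProduct, Pi.sub_apply]
  fun_prop

lemma contDiff_barrier {k : WithTop ℕ∞} : ContDiff ℝ k (barrier κ l m x₀) := by
  unfold barrier
  have := contDiff_dist_sq (x₀ := x₀) (k := k)
  fun_prop

lemma fderiv_coord (k : Fin n) (z v : (Fin n → ℝ) × ℝ) :
    fderiv ℝ (fun z : (Fin n → ℝ) × ℝ => (z.1 - x₀) k) z v = v.1 k := by
  have h : HasFDerivAt (fun z : (Fin n → ℝ) × ℝ => (z.1 - x₀) k)
      ((ContinuousLinearMap.proj k).comp (ContinuousLinearMap.fst ℝ (Fin n → ℝ) ℝ)) z :=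
    ((ContinuousLinearMap.proj k).comp
      (ContinuousLinearMap.fst ℝ (Fin n → ℝ) ℝ)).hasFDerivAt.sub_const _
  rw [h.fderiv]
  rfl

lemma fderiv_time (z v : (Fin n → ℝ) × ℝ) :
    fderiv ℝ (fun z : (Fin n → ℝ) × ℝ => l * z.2 - m) z v = l * v.2 := by
  have h : HasFDerivAt (fun z : (Fin n → ℝ) × ℝ => l * z.2 - m)
      (l • ContinuousLinearMap.snd ℝ (Fin n → ℝ) ℝ) z :=
    (l • ContinuousLinearMap.snd ℝ (Fin n → ℝ) ℝ).hasFDerivAt.sub_const _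
  rw [h.fderiv]
  rfl

lemma fderiv_barrier_apply (z v : (Fin n → ℝ) × ℝ) :
    fderiv ℝ (barrier κ l m x₀) z v = -(2 * κ) * ((z.1 - x₀) ⬝ᵥ v.1) + l * v.2 := by
  have h1 : DifferentiableAt ℝ (fun z : (Fin n → ℝ) × ℝ => (z.1 - x₀) ⬝ᵥ (z.1 - x₀)) z :=
    contDiff_dist_sq.contDiffAt.differentiableAt one_ne_zero
  unfold barrier
  rw [fderiv_fun_add (by fun_prop) (by fun_prop), add_apply, fderiv_time,
    fderiv_const_mul h1, smul_apply,
    fderiv_sum_sq_apply (p := fun z : (Fin n → ℝ) × ℝ => z.1 - x₀)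
      (by simp only [Pi.sub_apply]; fun_prop)]
  simp only [fderiv_coord, dotProduct, smul_eq_mul]
  ring

lemma fderiv_fderiv_barrier_apply (z v w : (Fin n → ℝ) × ℝ) :
    fderiv ℝ (fun z => fderiv ℝ (barrier κ l m x₀) z v) z w = -(2 * κ) * (w.1 ⬝ᵥ v.1) := by
  simp only [fderiv_barrier_apply]
  have h : HasFDerivAt (fun z : (Fin n → ℝ) × ℝ => (z.1 - x₀) ⬝ᵥ v.1)
      (∑ k, (v.1 k) • ((ContinuousLinearMap.proj k).comp
        (ContinuousLinearMap.fst ℝ (Fin n → ℝ) ℝ))) z := by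
    have h2 : ∀ k : Fin n, HasFDerivAt (fun z : (Fin n → ℝ) × ℝ => (z.1 - x₀) k * v.1 k)
        ((v.1 k) • ((ContinuousLinearMap.proj k).comp
        (ContinuousLinearMap.fst ℝ (Fin n → ℝ) ℝ))) z := fun k =>
      (((ContinuousLinearMap.proj k).comp
        (ContinuousLinearMap.fst ℝ (Fin n → ℝ) ℝ)).hasFDerivAt.sub_const _).mul_const _
    exact HasFDerivAt.fun_sum fun k _ => h2 k
  rw [((h.const_mul (-(2 * κ))).add_const _).fderiv]
  simp [dotProduct, sum_apply, mul_comm]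

end Barrier

section Maximum
variable {n : ℕ} {a : (Fin n → ℝ) → (Fin n → ℝ) →L[ℝ] (Fin n → ℝ) →L[ℝ] ℝ} {c C : ℝ}

lemma trace_le (H : IsAsymptoticallyEven a c C) (p : Fin n → ℝ) :
    ∑ i, a p (Pi.single i 1) (Pi.single i 1) ≤ n * C := by
  have h : ∀ i ∈ Finset.univ, a p (Pi.single i 1) (Pi.single i 1) ≤ C := fun i _ => by
    simpa [Pi.norm_single] using
      (le_abs_self _).trans (H.bound p (Pi.single i 1) (Pi.single i 1))
  simpa using Finset.sum_le_card_nsmul _ _ _ h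

/-- The second-order part of the maximum principle: the combination of the Hessian and of the
time derivative of `log |Du|² + 2 m log y`. -/
lemma second_order_combination {D : (Fin n → ℝ) →L[ℝ] (Fin n → ℝ) →L[ℝ] (Fin n → ℝ) →L[ℝ] ℝ}
    {B : (Fin n → ℝ) →L[ℝ] (Fin n → ℝ) →L[ℝ] ℝ} {p σ : Fin n → ℝ} {U : Fin n → Fin n → ℝ}
    {W : Fin n → Fin n → Fin n → ℝ} {pt : Fin n → ℝ} {b m s κ l : ℝ} (hs : 0 < s)
    (hU : ∀ i j, U i j = U j i) (hgrad : ∑ k, p k • U k = -(s * b) • σ)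
    (hpt : ∀ k, pt k = ∑ i, ∑ j, (D (U k) (Pi.single i 1) (Pi.single j 1) * U j i +
      B (Pi.single i 1) (Pi.single j 1) * W k i j))
    (hhess : ∑ i, ∑ j, B (Pi.single i 1) (Pi.single j 1) *
      (2 * ∑ k, (U k i * U k j + p k * W k i j) / s - 4 * b ^ 2 * σ i * σ j +
        2 * b * (U j i - 2 * κ * (Pi.single i 1 : Fin n → ℝ) j) - 2 * b ^ 2 / m * σ i * σ j) ≤ 0)
    (htime : 0 ≤ 2 * ∑ k, p k * pt k / s + 2 * b *
      (∑ i, ∑ j, B (Pi.single i 1) (Pi.single j 1) * U j i + l)) :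
    0 ≤ (2 + 1 / m) * b ^ 2 * B σ σ - (∑ k, B (U k) (U k)) / s -
      b * ∑ k, D σ (Pi.single k 1) (U k) +
      b * (l + 2 * κ * ∑ i, B (Pi.single i 1) (Pi.single i 1)) := by
  set A : Fin n → Fin n → ℝ := fun i j => B (Pi.single i 1) (Pi.single j 1) with hA
  have hBB : ∀ ξ : Fin n → ℝ, ∑ i, ∑ j, A i j * (ξ i * ξ j) = B ξ ξ := fun ξ => by
    rw [clm_apply_apply_eq_sum]
    refine Finset.sum_congr rfl fun i _ => ?_
    rw [clm_apply_eq_sum, Finset.mul_sum]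
    exact Finset.sum_congr rfl fun j _ => by simp only [A]; ring
  have hS1 : ∑ i, ∑ j, A i j * ∑ k, U k i * U k j = ∑ k, B (U k) (U k) := by
    simp only [← hBB, Finset.mul_sum]
    rw [Finset.sum_comm (γ := Fin n) (s := Finset.univ) (t := Finset.univ)
      (f := fun k i => ∑ j, A i j * (U k i * U k j))]
    exact Finset.sum_congr rfl fun i _ => Finset.sum_comm
  have htr : ∑ i, ∑ j, A i j * (Pi.single i 1 : Fin n → ℝ) j =
      ∑ i, B (Pi.single i 1) (Pi.single i 1) := by
    simp [A, Pi.single_apply]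
  have hS4 : ∑ k, p k * ∑ i, ∑ j, D (U k) (Pi.single i 1) (Pi.single j 1) * U j i =
      -(s * b) * ∑ k, D σ (Pi.single k 1) (U k) := by
    have h1 : ∀ i j, ∑ k, p k * (D (U k) (Pi.single i 1) (Pi.single j 1) * U j i) =
        -(s * b) * (D σ (Pi.single i 1) (Pi.single j 1) * U i j) := fun i j => by
      have h2 : D (∑ k, p k • U k) (Pi.single i 1) (Pi.single j 1) =
          -(s * b) * D σ (Pi.single i 1) (Pi.single j 1) := by simp [hgrad]
      rw [← mul_assoc, ← h2, hU i j, map_sum, sum_apply, sum_apply, Finset.sum_mul]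
      exact Finset.sum_congr rfl fun k _ => by simp [mul_assoc]
    simp only [clm_apply_eq_sum _ (U _), Finset.mul_sum]
    rw [Finset.sum_comm]
    refine Finset.sum_congr rfl fun i _ => ?_
    rw [Finset.sum_comm]
    exact Finset.sum_congr rfl fun j _ => h1 i j
  have hW : ∑ k, p k * pt k = ∑ k, p k * ∑ i, ∑ j, D (U k) (Pi.single i 1) (Pi.single j 1) * U j i +
      ∑ i, ∑ j, A i j * ∑ k, p k * W k i j := by
    have h1 : ∑ i, ∑ j, A i j * ∑ k, p k * W k i j = ∑ k, p k * ∑ i, ∑ j, A i j * W k i j := by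
      simp only [Finset.mul_sum]
      rw [Finset.sum_comm (s := (Finset.univ : Finset (Fin n))) (t := Finset.univ)
        (f := fun k i => ∑ j, p k * (A i j * W k i j))]
      refine Finset.sum_congr rfl fun i _ => ?_
      rw [Finset.sum_comm]
      exact Finset.sum_congr rfl fun j _ => Finset.sum_congr rfl fun k _ => by ring
    rw [h1, ← Finset.sum_add_distrib]
    refine Finset.sum_congr rfl fun k _ => ?_
    rw [hpt, ← mul_add, ← Finset.sum_add_distrib]
    simp only [A, Finset.sum_add_distrib]
  have hH : ∑ i, ∑ j, A i j *
      (2 * ∑ k, (U k i * U k j + p k * W k i j) / s - 4 * b ^ 2 * σ i * σ j +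
        2 * b * (U j i - 2 * κ * (Pi.single i 1 : Fin n → ℝ) j) - 2 * b ^ 2 / m * σ i * σ j) =
      2 / s * (∑ i, ∑ j, A i j * ∑ k, U k i * U k j) +
      2 / s * (∑ i, ∑ j, A i j * ∑ k, p k * W k i j) -
      (4 * b ^ 2 + 2 * b ^ 2 / m) * (∑ i, ∑ j, A i j * (σ i * σ j)) +
      2 * b * (∑ i, ∑ j, A i j * U j i) - 4 * b * κ *
        ∑ i, ∑ j, A i j * (Pi.single i 1 : Fin n → ℝ) j := by
    simp only [Finset.mul_sum (s := Finset.univ) (a := 2 / s), 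
      Finset.mul_sum (s := Finset.univ) (a := 4 * b ^ 2 + 2 * b ^ 2 / m), Finset.mul_sum
        (s := Finset.univ) (a := 2 * b),
      Finset.mul_sum (s := Finset.univ) (a := 4 * b * κ), ← Finset.sum_sub_distrib, ← Finset.sum_add_distrib]
    refine Finset.sum_congr rfl fun i _ => Finset.sum_congr rfl fun j _ => ?_
    rw [← Finset.sum_div, Finset.sum_add_distrib]
    ring
  have htime' : 0 ≤ 2 / s * (∑ k, p k * pt k) + 2 * b *
      (∑ i, ∑ j, A i j * U j i + l) := by
    rw [← Finset.sum_div] at htime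
    convert htime using 2
    ring
  have hhess' := hH ▸ hhess
  rw [hS1, hBB, htr] at hhess'
  rw [hW, hS4] at htime'
  have h4 : 2 / s * (-(s * b) * ∑ k, D σ (Pi.single k 1) (U k)) =
    -2 * (b * ∑ k, D σ (Pi.single k 1) (U k)) := by field_simp
  have h5 : 2 / s * (∑ k, B (U k) (U k)) = 2 * ((∑ k, B (U k) (U k)) / s) := by ring
  have h6 : (4 * b ^ 2 + 2 * b ^ 2 / m) * B σ σ = 2 * ((2 + 1 / m) * b ^ 2 * B σ σ) := by ring
  linarith [h4, h5, h6, mul_add (2 / s) (-(s * b) * ∑ k, D σ (Pi.single k 1) (U k))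
    (∑ i, ∑ j, A i j * ∑ k, p k * W k i j)]

/-- At an interior maximum of `log |Du|² + 2 m log y`, where `y` is `u` plus a barrier and the
gradient is large, the weight `m` is controlled by the barrier. -/
lemma IsAsymptoticallyEven.weight_le_of_max (H : IsAsymptoticallyEven a c C) {τ P : ℝ}
    (hP : 0 < P)
    (hcore : ∀ p, P ≤ ‖p‖ → ∀ η, ‖η‖ ≤ τ → ∀ (b : ℝ) (U : Fin n → Fin n → ℝ),
      (∀ i j, U i j = U j i) → ∑ k, p k • U k = -((p ⬝ᵥ p) * b) • (p - η) →
      5 / 2 * b ^ 2 * a p (p - η) (p - η) - (∑ k, a p (U k) (U k)) / (p ⬝ᵥ p) -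
        b * ∑ k, fderiv ℝ a p (p - η) (Pi.single k 1) (U k) ≤ -(c / 4) * b ^ 2)
    {u : (Fin n → ℝ) × ℝ → ℝ} {z : (Fin n → ℝ) × ℝ} (hu : ContDiffAt ℝ 3 u z)
    (hsol : ∀ᶠ z in nhds z, SolvesAt a u z) {m κ l m₀ : ℝ} {x₀ : Fin n → ℝ} (hm : 2 ≤ m)
    (hκ : 0 ≤ κ) (hy : 0 < u z + barrier κ l m₀ x₀ z) (hp : P ≤ ‖spaceGrad u z‖)
    (hη : ‖(2 * κ) • (z.1 - x₀)‖ ≤ τ) {ψ : (Fin n → ℝ) × ℝ → ℝ}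
    (hψ : ψ = fun z => Real.log (spaceGrad u z ⬝ᵥ spaceGrad u z) +
      2 * m * Real.log (u z + barrier κ l m₀ x₀ z))
    (hspace : ∀ ξ : Fin n → ℝ, IsLocalMax (fun h : ℝ => ψ (z + h • (ξ, (0 : ℝ)))) 0)
    (htime : ∀ᶠ h : ℝ in nhdsWithin 0 (Iic 0), ψ (z + h • (0, 1)) ≤ ψ z) :
    m * (c / 4) ≤ (u z + barrier κ l m₀ x₀ z) * (l + 2 * κ * (n * C)) := by
  set p := spaceGrad u z with hp_def
  set y : (Fin n → ℝ) × ℝ → ℝ := fun z => u z + barrier κ l m₀ x₀ z with hy_def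
  set g : (Fin n → ℝ) × ℝ → ℝ := fun z => spaceGrad u z ⬝ᵥ spaceGrad u z with hg_def
  set U : Fin n → Fin n → ℝ := fun k j => fderiv ℝ (fun z => spaceGrad u z k) z (Pi.single j 1, 0)
    with hU_def
  set W : Fin n → Fin n → Fin n → ℝ := fun k i j =>
    fderiv ℝ (fun z => fderiv ℝ (fun z => spaceGrad u z k) z (Pi.single j 1, 0)) z
      (Pi.single i 1, 0) with hW_def
  set σ := p - (2 * κ) • (z.1 - x₀) with hσ
  set b := m / y z with hb
  have hy' : 0 < y z := hy
  have hp0 : p ≠ 0 := fun h => by rw [h, norm_zero] at hp; linarith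
  have hs : 0 < g z := by
    exact (Finset.sum_nonneg fun k _ => mul_self_nonneg _).lt_of_ne'
      (dotProduct_self_eq_zero.not.2 hp0)
  have hu2 : ContDiffAt ℝ 2 u z := hu.of_le (by norm_num)
  have hpd := contDiffAt_spaceGrad_apply hu
  have hyd : ContDiffAt ℝ 2 y z := hu2.add contDiff_barrier.contDiffAt
  have hgd : ContDiffAt ℝ 2 g z := by
    simp only [hg_def, dotProduct]
    exact ContDiffAt.sum fun k _ => (hpd k).mul (hpd k)
  have hgl : ContDiffAt ℝ 2 (fun z => Real.log (g z)) z := hgd.log hs.ne'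
  have hyl : ContDiffAt ℝ 2 (fun z => Real.log (y z)) z := hyd.log hy'.ne'
  have hψd : ContDiffAt ℝ 2 ψ z := by
    rw [hψ]
    exact hgl.add (contDiffAt_const.mul hyl)
  have hy1 : ∀ v, fderiv ℝ y z v =
      fderiv ℝ u z v + (-(2 * κ) * ((z.1 - x₀) ⬝ᵥ v.1) + l * v.2) := fun v => by
    rw [hy_def, fderiv_fun_add (hu2.differentiableAt (by norm_num))
      (contDiff_barrier.contDiffAt.differentiableAt one_ne_zero), add_apply, fderiv_barrier_apply]
  have hyσ : ∀ j, fderiv ℝ y z (Pi.single j 1, 0) = σ j := fun j => by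
    rw [hy1]
    simp [hσ, hp_def, spaceGrad]
    ring
  have hψ1 : ∀ v, fderiv ℝ ψ z v = 2 * (∑ k, p k * fderiv ℝ (fun z => spaceGrad u z k) z v) / g z +
      2 * m * (fderiv ℝ y z v / y z) := fun v => by
    rw [hψ, fderiv_fun_add (hgl.differentiableAt (by norm_num))
      ((hyl.differentiableAt (by norm_num)).const_mul _), add_apply,
      fderiv_const_mul (hyl.differentiableAt (by norm_num)), smul_apply, smul_eq_mul,
      fderiv_log_apply (hyd.differentiableAt (by norm_num)) hy'.ne',
      fderiv_log_apply (hgd.differentiableAt (by norm_num)) hs.ne',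
      fderiv_sum_sq_apply fun k => (hpd k).differentiableAt (by norm_num)]
  have hUs : ∀ i j, U i j = U j i := fun i j => fderiv_spaceGrad_comm hu i j
  have hgradj : ∀ j, ∑ k, p k * U k j = -(g z * b) * σ j := fun j => by
    have h := fderiv_eq_zero_of_isLocalMax_line (hψd.differentiableAt (by norm_num))
      (hspace (Pi.single j 1))
    rw [hψ1, hyσ] at h
    rw [hb]
    field_simp at h ⊢
    linear_combination h / 2
  have hgrad : ∑ k, p k • U k = -(g z * b) • σ := by
    ext j
    simpa using hgradj j
  have hψ2 : ∀ i j, fderiv ℝ (fun z => fderiv ℝ ψ z (Pi.single j 1, 0)) z (Pi.single i 1, 0) =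
      2 * ∑ k, (U k i * U k j + p k * W k i j) / g z - 4 * b ^ 2 * σ i * σ j +
        2 * b * (U j i - 2 * κ * (Pi.single i 1 : Fin n → ℝ) j) -
        2 * b ^ 2 / m * σ i * σ j := fun i j => by
    rw [hψ, fderiv_fderiv_add_apply hgl (contDiffAt_const.mul hyl),
      fderiv_fderiv_const_mul_apply hyl, fderiv_fderiv_log_apply hgd hs.ne',
      fderiv_fderiv_log_apply hyd hy'.ne', fderiv_fderiv_sum_sq_apply hpd,
      fderiv_sum_sq_apply fun k => (hpd k).differentiableAt (by norm_num),
      fderiv_sum_sq_apply fun k => (hpd k).differentiableAt (by norm_num),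
      fderiv_fderiv_add_apply hu2 contDiff_barrier.contDiffAt, fderiv_fderiv_barrier_apply,
      hyσ, hyσ]
    have h1 := hgradj i
    have h2 := hgradj j
    have h3 : fderiv ℝ (fun z => fderiv ℝ u z (Pi.single j 1, 0)) z (Pi.single i 1, 0) =
      U j i := rfl
    simp only [hU_def] at h1 h2
    have h4 : (Pi.single i 1 : Fin n → ℝ) ⬝ᵥ Pi.single j 1 = (Pi.single i 1 : Fin n → ℝ) j := by
      simp
    have h5 : ∑ k, (fderiv ℝ (fun z => spaceGrad u z k) z (Pi.single i 1, 0) *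
        fderiv ℝ (fun z => spaceGrad u z k) z (Pi.single j 1, 0) + p k *
        fderiv ℝ (fun z => fderiv ℝ (fun z => spaceGrad u z k) z (Pi.single j 1, 0)) z
          (Pi.single i 1, 0)) = ∑ k, (U k i * U k j + p k * W k i j) := rfl
    rw [h1, h2, h3, h4, h5, ← Finset.sum_div, hb]
    generalize ∑ k, (U k i * U k j + p k * W k i j) = Q
    generalize (Pi.single i 1 : Fin n → ℝ) j = δ
    generalize y z = Y at hy' ⊢
    generalize g z = G at hs ⊢
    generalize U j i = V
    generalize σ i = a₁
    generalize σ j = a₂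
    have hm0 : m ≠ 0 := by linarith
    field_simp
    ring
  have hhess := sum_fderiv_fderiv_nonpos hψd hspace (H.symm p) (H.nonneg p)
  simp only [hψ2] at hhess
  have ht := fderiv_nonneg_of_left_max (hψd.differentiableAt (by norm_num)) htime
  rw [hψ1, hy1, show fderiv ℝ u z (0, 1) = _ from hsol.self_of_nhds] at ht
  have hcomb := second_order_combination hs hUs hgrad (fderiv_spaceGrad_time H.contDiff hu hsol)
    hhess (l := l) (by
      rw [← Finset.sum_div]
      convert ht using 1
      simp only [hb, hU_def, dotProduct_zero, mul_zero, mul_one, zero_add]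
      ring)
  have hc := hcore p hp _ hη b U hUs hgrad
  have h0 := H.nonneg p σ
  have hb0 : 0 < b := div_pos (by linarith) hy'
  have htr := trace_le H p
  have h1 : (2 + 1 / m) * b ^ 2 * a p σ σ ≤ 5 / 2 * b ^ 2 * a p σ σ := by
    have : 1 / m ≤ 1 / 2 := one_div_le_one_div_of_le (by norm_num) hm
    gcongr
    linarith
  have h2 : b * (l + 2 * κ * ∑ i, a p (Pi.single i 1) (Pi.single i 1)) ≤
      b * (l + 2 * κ * (n * C)) := by gcongr
  have h3 : b * (b * (c / 4)) ≤ b * (l + 2 * κ * (n * C)) := by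
    have : (∑ k, a p (U k) (U k)) / (p ⬝ᵥ p) = (∑ k, a p (U k) (U k)) / g z := rfl
    linarith
  have h4 := le_of_mul_le_mul_left h3 hb0
  rw [hb, div_mul_eq_mul_div, div_le_iff₀ hy'] at h4
  linarith

end Maximum

section InteriorEstimate
variable {n : ℕ} {a : (Fin n → ℝ) → (Fin n → ℝ) →L[ℝ] (Fin n → ℝ) →L[ℝ] ℝ} {c C : ℝ}

lemma dotProduct_self_le_card_mul_sq_norm (p : Fin n → ℝ) : p ⬝ᵥ p ≤ n * ‖p‖ ^ 2 := by
  have h : ∀ i ∈ Finset.univ, p i * p i ≤ ‖p‖ ^ 2 := fun i _ => by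
    have := norm_le_pi_norm p i
    rw [← sq, ← sq_abs]
    exact pow_le_pow_left₀ (abs_nonneg _) this 2
  simpa [dotProduct] using Finset.sum_le_card_nsmul _ _ _ h

lemma sq_norm_le_dotProduct_self (p : Fin n → ℝ) : ‖p‖ ^ 2 ≤ p ⬝ᵥ p := by
  have h0 : 0 ≤ p ⬝ᵥ p := Finset.sum_nonneg fun k _ => mul_self_nonneg _
  have h : ‖p‖ ≤ √(p ⬝ᵥ p) := (pi_norm_le_iff_of_nonneg (Real.sqrt_nonneg _)).2 fun i => by
    refine Real.le_sqrt_of_sq_le ?_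
    rw [Real.norm_eq_abs, sq_abs, sq]
    exact Finset.single_le_sum (f := fun k => p k * p k) (fun k _ => mul_self_nonneg _)
      (Finset.mem_univ i)
  calc ‖p‖ ^ 2 ≤ √(p ⬝ᵥ p) ^ 2 := pow_le_pow_left₀ (norm_nonneg _) h 2
    _ = p ⬝ᵥ p := Real.sq_sqrt h0

lemma isCompact_paraboloid {κ ρ : ℝ} (hκ : 0 < κ) (x₀ : Fin n → ℝ) (t₁ t₂ : ℝ) :
    IsCompact {z : (Fin n → ℝ) × ℝ | κ * ((z.1 - x₀) ⬝ᵥ (z.1 - x₀)) ≤ ρ ∧ z.2 ∈ Icc t₁ t₂} := by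
  refine ((isCompact_closedBall x₀ √(ρ / κ)).prod (isCompact_Icc (a := t₁)
    (b := t₂))).of_isClosed_subset
    ?_ ?_
  · have h : Continuous fun z : (Fin n → ℝ) × ℝ => (z.1 - x₀) ⬝ᵥ (z.1 - x₀) :=
      (contDiff_dist_sq (k := 1)).continuous
    exact (isClosed_le (continuous_const.mul h) continuous_const).inter
      (isClosed_Icc.preimage continuous_snd)
  · rintro z ⟨h1, h2⟩
    refine ⟨?_, h2⟩
    rw [mem_closedBall_iff_norm]
    refine Real.le_sqrt_of_sq_le ((sq_norm_le_dotProduct_self _).trans ?_)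
    rw [le_div_iff₀ hκ]
    linarith

lemma mul_nine_pow_le_exp {B D E c : ℝ} {m : ℕ} (hB : 0 ≤ B) (hD : 0 ≤ D) (hE : 0 ≤ E) (hc : 0 < c)
    (hm : m ≤ 48 / c * E + D + 3) :
    B * 9 ^ m ≤ Real.exp ((B + 9 + 3 * D + 144 / c) * (1 + E)) := by
  have h9 : (9 : ℝ) ≤ Real.exp 3 := by
    have h3 : Real.exp 3 = Real.exp 1 ^ 3 := by rw [← Real.exp_nat_mul]; norm_num
    have h4 : 2.7 < Real.exp 1 := by linarith [Real.exp_one_gt_d9]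
    rw [h3]
    calc (9 : ℝ) ≤ 2.7 ^ 3 := by norm_num
      _ ≤ _ := by gcongr
  calc B * 9 ^ m ≤ Real.exp B * Real.exp 3 ^ m := by
        gcongr
        linarith [Real.add_one_le_exp B]
    _ = Real.exp (B + m * 3) := by rw [Real.exp_add, Real.exp_nat_mul]
    _ ≤ _ := by
      gcongr
      have h1 : (48 / c * E + D + 3) * 3 = 144 / c * E + 3 * D + 9 := by ring
      have h2 : 0 ≤ (B + 9 + 3 * D) * E := by positivity
      have h3 : 0 < 144 / c := by positivity
      nlinarith

/-- Interior gradient estimate for bounded solutions of the quasilinear equation, independent of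
their initial gradient. -/
lemma IsAsymptoticallyEven.exists_gradient_estimate (H : IsAsymptoticallyEven a c C)
    (hc : 0 < c) (hC : 1 ≤ C) :
    ∃ L > 0, ∀ (T M : ℝ) (u : (Fin n → ℝ) × ℝ → ℝ), 0 < M →
      (∀ x, ∀ t ∈ Ioo 0 T, ContDiffAt ℝ 3 u (x, t) ∧ SolvesAt a u (x, t) ∧ |u (x, t)| ≤ M) →
      ∀ x, ∀ t ∈ Ioo 0 T,
        spaceGrad u (x, t) ⬝ᵥ spaceGrad u (x, t) ≤ Real.exp (L * (1 + M ^ 2 / t)) := by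
  obtain ⟨τ, hτ, P, hP, hcore⟩ := H.exists_trace_estimate hc hC
  refine ⟨n * P ^ 2 + 9 + 3 * (2 * τ ^ 2 * n * C / c) + 144 / c, by positivity, ?_⟩
  intro T M u hM hu x₀ t₀ ht₀
  have ht₀' : 0 < t₀ := ht₀.1
  set κ := τ ^ 2 / (12 * M) with hκ_def
  set l := 4 * M / t₀ with hl
  set X := 12 / c * (4 * M ^ 2 / t₀ + τ ^ 2 * n * C / 6) with hX
  set m := ⌈X⌉₊ + 2 with hm
  have hκ : 0 < κ := by positivity
  have hX0 : 0 ≤ X := by positivity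
  have hmX : X < m := by
    have := Nat.le_ceil X
    rw [hm]; push_cast; linarith
  have hmX' : (m : ℝ) < X + 3 := by
    have := Nat.ceil_lt_add_one hX0
    rw [hm]; push_cast; linarith
  have hm2 : (2 : ℝ) ≤ m := by rw [hm]; push_cast; linarith [Nat.cast_nonneg (α := ℝ) ⌈X⌉₊]
  set y : (Fin n → ℝ) × ℝ → ℝ := fun z => u z + barrier κ l (2 * M) x₀ z with hy
  set g : (Fin n → ℝ) × ℝ → ℝ := fun z => spaceGrad u z ⬝ᵥ spaceGrad u z with hg
  set G : (Fin n → ℝ) × ℝ → ℝ := fun z => g z * max (y z) 0 ^ (2 * m) with hG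
  set K : Set ((Fin n → ℝ) × ℝ) :=
    {z | κ * ((z.1 - x₀) ⬝ᵥ (z.1 - x₀)) ≤ 3 * M ∧ z.2 ∈ Icc (t₀ / 4) t₀} with hK
  have hΩ : ∀ z ∈ K, z.2 ∈ Ioo 0 T := fun z hz =>
    ⟨by linarith [hz.2.1], hz.2.2.trans_lt ht₀.2⟩
  have hyc : ∀ z : (Fin n → ℝ) × ℝ, z.2 ∈ Ioo 0 T → ContinuousAt y z := fun z hz =>
    (hu z.1 z.2 hz).1.continuousAt.add (contDiff_barrier (k := 1)).continuous.continuousAt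
  have hgc : ∀ z : (Fin n → ℝ) × ℝ, z.2 ∈ Ioo 0 T → ContinuousAt g z := fun z hz => by
    have hpd := contDiffAt_spaceGrad_apply (hu z.1 z.2 hz).1
    simp only [hg, dotProduct]
    exact tendsto_finsetSum _ fun k _ => (hpd k).continuousAt.mul (hpd k).continuousAt
  have hz₀ : (x₀, t₀) ∈ K := by
    refine ⟨?_, by linarith, le_rfl⟩
    simp only [sub_self, dotProduct_zero, mul_zero]
    positivity
  obtain ⟨z₁, hz₁, hmax⟩ := (isCompact_paraboloid hκ x₀ (t₀ / 4) t₀).exists_isMaxOn ⟨_, hz₀⟩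
    (f := G) fun z hz => ((hgc z (hΩ z hz)).mul
      (((hyc z (hΩ z hz)).max continuousAt_const).pow _)).continuousWithinAt
  have hg0 : ∀ z, 0 ≤ g z := fun z => Finset.sum_nonneg fun k _ => mul_self_nonneg _
  have hyM : ∀ z : (Fin n → ℝ) × ℝ, z.2 ∈ Ioo 0 T →
      y z ≤ -κ * ((z.1 - x₀) ⬝ᵥ (z.1 - x₀)) + (l * z.2 - M) := fun z hz => by
    have := (abs_le.1 (hu z.1 z.2 hz).2.2).2
    simp only [hy, barrier]
    linarith
  have hlt : l * t₀ = 4 * M := by rw [hl]; field_simp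
  have hy₀ : M ≤ y (x₀, t₀) := by
    have := (abs_le.1 (hu x₀ t₀ ht₀).2.2).1
    simp only [hy, barrier, sub_self, dotProduct_zero, mul_zero, zero_add]
    linarith
  have hG₁ : g (x₀, t₀) * M ^ (2 * m) ≤ G z₁ := by
    refine le_trans ?_ (hmax hz₀)
    simp only [hG]
    gcongr
    · exact hg0 _
    · exact hy₀.trans (le_max_left _ _)
  change g (x₀, t₀) ≤ _
  rcases (hg0 (x₀, t₀)).eq_or_lt with h0 | hgpos
  · rw [← h0]; positivity
  have hGpos : 0 < G z₁ := lt_of_lt_of_le (by positivity) hG₁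
  have hy₁ : 0 < y z₁ := by
    by_contra! h
    simp [hG, max_eq_right h] at hGpos
  have hg₁ : 0 < g z₁ := by
    rcases (hg0 z₁).eq_or_lt with h | h
    · simp [hG, ← h] at hGpos
    · exact h
  have hd0 : 0 ≤ (z₁.1 - x₀) ⬝ᵥ (z₁.1 - x₀) := Finset.sum_nonneg fun k _ => mul_self_nonneg _
  have hl0 : 0 < l := by positivity
  have hyM₁ := hyM z₁ (hΩ z₁ hz₁)
  have hlz : l * z₁.2 ≤ 4 * M := hlt ▸ mul_le_mul_of_nonneg_left hz₁.2.2 hl0.le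
  have hκd : κ * ((z₁.1 - x₀) ⬝ᵥ (z₁.1 - x₀)) < 3 * M := by linarith
  have hy3 : y z₁ ≤ 3 * M := by nlinarith
  have htz : t₀ / 4 < z₁.2 := by
    have : l * (t₀ / 4) < l * z₁.2 := by nlinarith
    exact lt_of_mul_lt_mul_left this hl0.le
  set ψ : (Fin n → ℝ) × ℝ → ℝ := fun z => Real.log (spaceGrad u z ⬝ᵥ spaceGrad u z) +
      2 * (m : ℝ) * Real.log (u z + barrier κ l (2 * M) x₀ z) with hψ
  have hψG : ∀ z, 0 < g z → 0 < y z → ψ z = Real.log (G z) := fun z h1 h2 => by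
    simp only [hG, max_eq_left h2.le]
    rw [Real.log_mul h1.ne' (by positivity), Real.log_pow]
    push_cast
    rfl
  have hloc : ∀ᶠ z in nhds z₁, z.2 ≤ z₁.2 → ψ z ≤ ψ z₁ := by
    have hd : Continuous fun z : (Fin n → ℝ) × ℝ => κ * ((z.1 - x₀) ⬝ᵥ (z.1 - x₀)) :=
      continuous_const.mul (contDiff_dist_sq (k := 1)).continuous
    filter_upwards [(hyc z₁ (hΩ z₁ hz₁)).eventually_const_lt hy₁,
      (hgc z₁ (hΩ z₁ hz₁)).eventually_const_lt hg₁,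
      hd.continuousAt.eventually_lt_const hκd,
      continuous_snd.continuousAt.eventually_const_lt htz] with z h1 h2 h3 h4 h5
    rw [hψG z h2 h1, hψG z₁ hg₁ hy₁]
    refine Real.log_le_log (by simp only [hG]; positivity) (hmax ⟨h3.le, h4.le, h5.trans hz₁.2.2⟩)
  have hgP : g z₁ ≤ n * P ^ 2 := by
    have hsmall : ‖spaceGrad u z₁‖ < P := by
      by_contra! hlarge
      have hη : ‖(2 * κ) • (z₁.1 - x₀)‖ ≤ τ := by
        refine abs_le_of_sq_le_sq' ?_ hτ.le |>.2
        rw [norm_smul, mul_pow, Real.norm_eq_abs, sq_abs]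
        have h1 := sq_norm_le_dotProduct_self (z₁.1 - x₀)
        have h2 : 12 * M * κ = τ ^ 2 := by rw [hκ_def]; field_simp
        nlinarith [mul_le_mul_of_nonneg_left h1 (sq_nonneg κ), mul_lt_mul_of_pos_left hκd hκ]
      have hsol : ∀ᶠ z in nhds z₁, SolvesAt a u z := by
        filter_upwards [(isOpen_Ioo.preimage continuous_snd).mem_nhds (hΩ z₁ hz₁)] with z hz
        exact (hu z.1 z.2 hz).2.1
      have hpt := H.weight_le_of_max (by linarith) hcore (hu z₁.1 z₁.2 (hΩ z₁ hz₁)).1 hsol hm2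
        hκ.le hy₁ hlarge hη hψ (fun ξ => by
          filter_upwards [(tendsto_line (z := z₁) (ξ, (0 : ℝ))).eventually hloc] with h hh
          simpa using hh (by simp)) (by
          filter_upwards [((tendsto_line (z := z₁) ((0 : Fin n → ℝ), (1 : ℝ))).mono_left
            nhdsWithin_le_nhds).eventually hloc, self_mem_nhdsWithin] with h hh hh'
          exact hh (by simpa using hh'))
      have h1 : (m : ℝ) * (c / 4) ≤ 3 * M * (l + 2 * κ * (n * C)) := by
        refine hpt.trans ?_
        gcongr
      have h2 : 3 * M * (l + 2 * κ * (n * C)) = X * (c / 4) := by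
        rw [hX, hl, hκ_def]
        field_simp
        ring
      nlinarith
    refine (dotProduct_self_le_card_mul_sq_norm _).trans ?_
    gcongr
  have hG₂ : g (x₀, t₀) * M ^ (2 * m) ≤ n * P ^ 2 * 9 ^ m * M ^ (2 * m) := by
    refine hG₁.trans ?_
    simp only [hG, max_eq_left hy₁.le]
    calc g z₁ * y z₁ ^ (2 * m) ≤ n * P ^ 2 * (3 * M) ^ (2 * m) := by gcongr
      _ = n * P ^ 2 * 9 ^ m * M ^ (2 * m) := by
        rw [mul_pow, pow_mul 3]
        norm_num
        ring
  refine (le_of_mul_le_mul_right hG₂ (by positivity)).trans ?_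
  refine mul_nine_pow_le_exp (by positivity) (by positivity) (by positivity) hc ?_
  rw [hX] at hmX'
  refine hmX'.le.trans (le_of_eq ?_)
  field_simp
  ring

end InteriorEstimate

section Slices
variable {n : ℕ} {F : (Fin (n + 1) → ℝ) → ℝ} {u : (Fin n → ℝ) × ℝ → ℝ} {T : ℝ}

lemma IsAreaIntegrand.exists_le_norm (hF : IsAreaIntegrand F) :
    ∃ C > 0, ∀ ν : Fin (n + 1) → ℝ, ν ≠ 0 → F ν ≤ C * ‖ν‖ := by
  have hs : Metric.sphere (0 : Fin (n + 1) → ℝ) 1 ⊆ {0}ᶜ := fun ν hν h0 => by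
    rw [mem_singleton_iff] at h0
    simp [h0] at hν
  obtain ⟨C, hC⟩ := (isCompact_sphere (0 : Fin (n + 1) → ℝ) 1).exists_bound_of_continuousOn
    (hF.2.2.1.continuousOn.mono hs)
  refine ⟨|C| + 1, by positivity, fun ν hν => ?_⟩
  have hν' : 0 < ‖ν‖ := norm_pos_iff.2 hν
  have h1 := hC (‖ν‖⁻¹ • ν) (by simp [norm_smul, hν'.ne'])
  rw [hF.2.2.2.1 _ _ (inv_pos.2 hν'), Real.norm_eq_abs] at h1
  have h2 : ‖ν‖⁻¹ * F ν ≤ |C| + 1 := by linarith [le_abs_self (‖ν‖⁻¹ * F ν), le_abs_self C]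
  rwa [inv_mul_le_iff₀ hν', mul_comm] at h2

lemma hasFDerivAt_slice {f : (Fin n → ℝ) × ℝ → ℝ} {S : Set ℝ} {x : Fin n → ℝ} {t : ℝ}
    (hf : DifferentiableWithinAt ℝ f (univ ×ˢ S) (x, t)) (ht : t ∈ S) :
    HasFDerivAt (fun y => f (y, t))
      ((fderivWithin ℝ f (univ ×ˢ S) (x, t)).comp (ContinuousLinearMap.inl ℝ (Fin n → ℝ) ℝ)) x := by
  rw [← hasFDerivWithinAt_univ]
  have hmaps : MapsTo (fun y => (y, t)) univ ((univ : Set (Fin n → ℝ)) ×ˢ S) :=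
    fun y _ => ⟨mem_univ _, ht⟩
  exact hf.hasFDerivWithinAt.comp x (hasFDerivAt_prodMk_left x t).hasFDerivWithinAt hmaps

lemma fderiv_slice {f : (Fin n → ℝ) × ℝ → ℝ} {x : Fin n → ℝ} {t : ℝ}
    (hf : DifferentiableAt ℝ f (x, t)) (v : Fin n → ℝ) :
    fderiv ℝ (fun y => f (y, t)) x v = fderiv ℝ f (x, t) (v, 0) := by
  have h : HasFDerivAt (fun y => f (y, t)) _ x :=
    hf.hasFDerivAt.comp x (hasFDerivAt_prodMk_left x t)
  rw [h.fderiv]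
  rfl

lemma continuousOn_nuVec (hT : 0 < T) (hu : ContDiffOn ℝ 3 u (univ ×ˢ Icc 0 T)) (x : Fin n → ℝ) :
    ContinuousOn (fun t => nuVec u x t) (Icc 0 T) := by
  have hd : UniqueDiffOn ℝ ((univ : Set (Fin n → ℝ)) ×ˢ Icc 0 T) :=
    uniqueDiffOn_univ.prod (uniqueDiffOn_Icc hT)
  have hc : ContinuousOn (fun t => fderivWithin ℝ u (univ ×ˢ Icc 0 T) (x, t)) (Icc 0 T) :=
    (hu.continuousOn_fderivWithin hd (by norm_num)).comp (by fun_prop) fun t ht => ⟨mem_univ _, ht⟩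
  refine continuousOn_pi.2 fun j => ?_
  refine Fin.cases ?_ (fun i => ?_) j
  · simp only [nuVec, Fin.cons_zero]
    exact continuousOn_const
  · simp only [nuVec, Fin.cons_succ]
    refine (hc.clm_apply (continuousOn_const (c := (Pi.single i 1, 0)))).congr fun t ht => ?_
    rw [(hasFDerivAt_slice
      (hu.differentiableOn (by norm_num) (x, t) ⟨mem_univ _, ht⟩) ht).fderiv]
    rfl

lemma IsFlowSolution.contDiffAt (hu : IsFlowSolution F u T) (x : Fin n → ℝ) {t : ℝ}
    (ht : t ∈ Ioo 0 T) : ContDiffAt ℝ 3 u (x, t) :=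
  hu.1.contDiffAt (prod_mem_nhds univ_mem (Icc_mem_nhds ht.1 ht.2))

lemma IsFlowSolution.nuVec_eq (hu : IsFlowSolution F u T) (x : Fin n → ℝ) {t : ℝ}
    (ht : t ∈ Ioo 0 T) : nuVec u x t = Fin.cons (-1) (spaceGrad u (x, t)) := by
  simp only [nuVec, fderiv_slice ((hu.contDiffAt x ht).differentiableAt (by norm_num))]
  rfl

lemma IsFlowSolution.solvesAt (hu : IsFlowSolution F u T) (x : Fin n → ℝ) {t : ℝ}
    (ht : t ∈ Ioo 0 T) : SolvesAt (graphForm F) u (x, t) := by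
  have hd := (hu.contDiffAt x ht).differentiableAt (by norm_num)
  have h1 : deriv (fun s => u (x, s)) t = fderiv ℝ u (x, t) (0, 1) := by
    have h : HasFDerivAt (fun s => u (x, s)) _ t :=
      hd.hasFDerivAt.comp t (hasFDerivAt_prodMk_right x t)
    rw [h.hasDerivAt.deriv]
    rfl
  have h2 : ∀ i j, pd2 u x t i j =
      fderiv ℝ (fun z => spaceGrad u z j) (x, t) (Pi.single i 1, 0) := fun i j => by
    rw [← fderiv_slice ((contDiffAt_spaceGrad_apply (hu.contDiffAt x ht) j).differentiableAt
      (by norm_num)), pd2]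
    congr 2
    funext y
    exact fderiv_slice ((hu.contDiffAt y ht).differentiableAt (by norm_num)) _
  rw [SolvesAt, ← h1, hu.2 x t (Ioo_subset_Icc_self ht)]
  simp only [graphForm_apply, anisoForm_apply_eq, horizontal_single, h2, hu.nuVec_eq x ht]

/-- Interior gradient estimate in terms of the integrand. -/
lemma IsAreaIntegrand.exists_flow_estimate (hF : IsAreaIntegrand F) (hsym : SymmCond F) :
    ∃ C > 0, ∃ L > 0, ∀ (T M : ℝ) (u : (Fin n → ℝ) × ℝ → ℝ), 0 < M → IsFlowSolution F u T →
      (∀ x, ∀ t ∈ Icc 0 T, |u (x, t)| ≤ M) →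
      ∀ x, ∀ t ∈ Ioc 0 T, F (nuVec u x t) ≤ C * Real.exp (L * (1 + M ^ 2 / t)) := by
  obtain ⟨C, hC, hFC⟩ := hF.exists_le_norm
  obtain ⟨c, hc, C', hC', H⟩ := hF.isAsymptoticallyEven_graphForm hsym
  obtain ⟨L, hL, hgrad⟩ := H.exists_gradient_estimate hc hC'
  refine ⟨C, hC, L, hL, fun T M u hM hu hb x t ht => ?_⟩
  have hT : 0 < T := ht.1.trans_le ht.2
  have hint : ∀ t ∈ Ioo 0 T, F (nuVec u x t) ≤ C * Real.exp (L * (1 + M ^ 2 / t)) := by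
    intro t ht
    have ht0 := ht.1
    have h := hgrad T M u hM (fun x t ht => ⟨hu.contDiffAt x ht, hu.solvesAt x ht,
      hb x t (Ioo_subset_Icc_self ht)⟩) x t ht
    rw [hu.nuVec_eq x ht]
    refine (hFC _ (cons_neg_one_ne_zero _)).trans ?_
    gcongr
    set X := L * (1 + M ^ 2 / t)
    have hX : 1 ≤ Real.exp X := Real.one_le_exp (by positivity)
    refine (pi_norm_le_iff_of_nonneg (by positivity)).2 fun j => ?_
    refine Fin.cases ?_ (fun i => ?_) j
    · simpa using hX
    · rw [Fin.cons_succ]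
      refine (norm_le_pi_norm _ i).trans (abs_le_of_sq_le_sq' ?_ (by positivity)).2
      exact ((sq_norm_le_dotProduct_self _).trans h).trans (le_self_pow₀ hX two_ne_zero)
  rcases ht.2.eq_or_lt with rfl | htT
  · have hν : ContinuousWithinAt (fun s => nuVec u x s) (Ioo 0 t) t :=
      (continuousOn_nuVec hT hu.1 x t ⟨hT.le, le_rfl⟩).mono Ioo_subset_Icc_self
    have hν0 : nuVec u x t ≠ 0 := cons_neg_one_ne_zero _
    have h1 : ContinuousWithinAt (fun s => F (nuVec u x s)) (Ioo 0 t) t :=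
      ((hF.contDiffAt hν0).continuousAt).comp_continuousWithinAt hν
    have h2 : ContinuousWithinAt (fun s => C * Real.exp (L * (1 + M ^ 2 / s))) (Ioo 0 t) t := by
      refine ContinuousAt.continuousWithinAt ?_
      fun_prop (disch := exact hT.ne')
    have : (nhdsWithin t (Ioo 0 t)).NeBot := by
      rw [← mem_closure_iff_nhdsWithin_neBot, closure_Ioo hT.ne]
      exact ⟨hT.le, le_rfl⟩
    exact le_of_tendsto_of_tendsto h1 h2 (eventually_mem_nhdsWithin.mono hint)
  · exact hint t ⟨ht.1, htT⟩

end Slices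

/-- The exponential bound is dominated by the asserted one for small times. -/
lemma mul_exp_le_rpow_mul_exp_mul_rpow {C L M R w t B q : ℝ} (hC : 0 < C) (hL : 0 < L) (hM : 0 < M)
    (ht : 0 < t) (htM : t ≤ M ^ 2) (htM' : t ≤ M ^ 4 / 4) (hw : w ≤ M) (hB : 0 < B)
    (hBR : B ≤ R ^ 2) (hq : q = 2 * (|Real.log C| + 2 * L + 2 * |Real.log (R ^ 2)|) + 2) :
    C * Real.exp (L * (1 + M ^ 2 / t)) ≤
      t ^ (q / 2) * Real.exp (4 * q * (w - 2 * M) ^ 2 / (4 * t)) * B ^ (-2 : ℝ) := by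
  set E := M ^ 2 / t with hE
  have hE1 : 1 ≤ E := (one_le_div ht).2 htM
  have hq0 : 0 < q := by rw [hq]; positivity
  have hlog : -E ≤ Real.log t := by
    set s := √t with hs
    have hs0 : 0 < s := Real.sqrt_pos.2 ht
    have hst : t = s ^ 2 := (Real.sq_sqrt ht.le).symm
    have h1 := Real.log_le_sub_one_of_pos (inv_pos.2 hs0)
    rw [Real.log_inv] at h1
    have h2 : 2 * s ≤ M ^ 2 := by
      refine (abs_le_of_sq_le_sq' ?_ (by positivity)).2
      rw [hst] at htM'
      nlinarith
    have h3 : 2 * s⁻¹ ≤ E := by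
      rw [hE, le_div_iff₀ ht, hst]
      field_simp
      linarith
    rw [hst, Real.log_pow]
    push_cast
    linarith
  have hw2 : q * E ≤ 4 * q * (w - 2 * M) ^ 2 / (4 * t) := by
    rw [hE, mul_assoc 4, mul_div_mul_left _ _ four_ne_zero, mul_div_assoc]
    have hsq : M ^ 2 ≤ (w - 2 * M) ^ 2 := by nlinarith
    gcongr
  have hBlog : Real.log B ≤ |Real.log (R ^ 2)| :=
    (Real.log_le_log hB hBR).trans (le_abs_self _)
  calc C * Real.exp (L * (1 + E)) = Real.exp (Real.log C + L * (1 + E)) := by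
        rw [Real.exp_add, Real.exp_log hC]
    _ ≤ Real.exp (Real.log t * (q / 2) + 4 * q * (w - 2 * M) ^ 2 / (4 * t) + Real.log B * -2) := by
        refine Real.exp_le_exp.2 ?_
        have h1 : -E * (q / 2) ≤ Real.log t * (q / 2) := by gcongr
        have h2 := le_abs_self (Real.log C)
        have h3 : q / 2 * E = (|Real.log C| + 2 * |Real.log (R ^ 2)| + 1) * E + 2 * L * E := by
          rw [hq]; ring
        have h4 : |Real.log C| + 2 * |Real.log (R ^ 2)| + 1 ≤
          (|Real.log C| + 2 * |Real.log (R ^ 2)| + 1) * E := le_mul_of_one_le_right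
            (by positivity) hE1
        have h5 : L ≤ L * E := le_mul_of_one_le_right hL.le hE1
        linarith
    _ = _ := by
        rw [Real.exp_add, Real.exp_add, Real.rpow_def_of_pos ht, Real.rpow_def_of_pos hB]

/-- Interior (in space and time) gradient estimate for
anisotropic mean curvature flow, under both the smallness-of-third-derivatives
condition with `C₁² < 2/√n` and the symmetry condition. -/
theorem interior_gradient_estimate
    {n : ℕ} (hn : 1 < n) (F : (Fin (n + 1) → ℝ) → ℝ)
    (hF : IsAreaIntegrand F) (C₁ : ℝ) (hC₁ : 0 < C₁)
    (hC₁small : C₁ ^ 2 < 2 / Real.sqrt n) (hsmall : SmallThird F C₁)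
    (hsym : SymmCond F) :
    ∃ A > (0 : ℝ), ∃ P > (0 : ℝ), ∃ k > (0 : ℝ), ∃ r > (1 : ℝ),
      ∀ M : ℝ, 0 < M → ∃ T' > (0 : ℝ),
        ∀ R : ℝ, 0 < R → ∃ q > (1 : ℝ),
          ∀ T : ℝ, 0 < T →
            ∀ u : (Fin n → ℝ) × ℝ → ℝ,
              IsFlowSolution F u T →
              (∀ (x : Fin n → ℝ) (t : ℝ), t ∈ Set.Icc 0 T → |u (x, t)| ≤ M) →
              ∀ (x : Fin n → ℝ) (t : ℝ), 0 < t → t ≤ min T' T →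
                (∑ i : Fin n, x i ^ 2) < R ^ 2 - 2 * k * t →
                F (nuVec u x t) ≤
                  max (t ^ (q / 2) *
                      Real.exp (A * q * (|u (x, t)| - 2 * M) ^ 2 / (4 * t)) *
                      (R ^ 2 - 2 * k * t - ∑ i : Fin n, x i ^ 2) ^ (-r)) P := by
  obtain ⟨C, hC, L, hL, h⟩ := hF.exists_flow_estimate hsym
  refine ⟨4, by norm_num, 1, one_pos, 1, one_pos, 2, by norm_num, fun M hM =>
    ⟨min (M ^ 2) (M ^ 4 / 4), by positivity, fun R hR =>
      ⟨2 * (|Real.log C| + 2 * L + 2 * |Real.log (R ^ 2)|) + 2,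
        by linarith [abs_nonneg (Real.log C), abs_nonneg (Real.log (R ^ 2))],
        fun T hT u hu hb x t ht htT hx => le_max_of_le_left ?_⟩⟩⟩
  obtain ⟨h1, h2⟩ := le_min_iff.1 htT
  obtain ⟨h3, h4⟩ := le_min_iff.1 h1
  have hx0 : 0 ≤ ∑ i, x i ^ 2 := Finset.sum_nonneg fun i _ => sq_nonneg _
  exact (h T M u hM hu hb x t ⟨ht, h2⟩).trans (mul_exp_le_rpow_mul_exp_mul_rpow hC hL hM ht h3 h4
    (hb x t ⟨ht.le, h2⟩) (by linarith) (by linarith) rfl)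
end

section
/- Let F : ℝ^(n+1) → ℝ be C³ on ℝ^(n+1)∖{0}, positively homogeneous of degree one, and satisfy the symmetry condition. Then for every nonzero p in the span of {φ¹,…,φⁿ}: (a) DF|_p(φ⁰) = 0; (b) D²F|_p(φ⁰,φʲ) = 0 for every j ∈ {1,…,n}; (c) D³F|_p(φ⁰,φʲ,φᵏ) = 0 for all j,k ∈ {1,…,n}; and (d) D³F|_p(φ⁰,φ⁰,φ⁰) = 0. -/
open Real Filter Set

/-- The reflection of `ℝ^(n+1)` that negates the `0`-th coordinate. -/
noncomputable def reflectZero (n : ℕ) : (Fin (n + 1) → ℝ) ≃L[ℝ] (Fin (n + 1) → ℝ) :=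
  ContinuousLinearEquiv.piCongrRight fun i =>
    if i = 0 then ContinuousLinearEquiv.neg ℝ else ContinuousLinearEquiv.refl ℝ ℝ

theorem reflectZero_apply {n : ℕ} (v : Fin (n + 1) → ℝ) (i : Fin (n + 1)) :
    reflectZero n v i = if i = 0 then -v i else v i := by
  by_cases h : i = 0 <;> simp [reflectZero, h]

theorem reflectZero_of_apply_zero {n : ℕ} {v : Fin (n + 1) → ℝ} (hv : v 0 = 0) :
    reflectZero n v = v := by
  ext i
  by_cases h : i = 0
  · subst h
    simp [reflectZero_apply, hv]
  · simp [reflectZero_apply, h]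

theorem reflectZero_single_zero (n : ℕ) :
    reflectZero n (Pi.single 0 1) = -Pi.single 0 1 := by
  ext i
  by_cases h : i = 0
  · subst h
    simp [reflectZero_apply]
  · simp [reflectZero_apply, h]

theorem reflectZero_single_succ {n : ℕ} (j : Fin n) :
    reflectZero n (Pi.single j.succ 1) = Pi.single j.succ 1 :=
  reflectZero_of_apply_zero (by simp [(Fin.succ_ne_zero j).symm])

theorem reflectZero_reflectZero {n : ℕ} (v : Fin (n + 1) → ℝ) :
    reflectZero n (reflectZero n v) = v := by
  ext i
  by_cases h : i = 0 <;> simp [reflectZero_apply, h]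

/-- A positively homogeneous function satisfying the symmetry condition is invariant under
the reflection in the `0`-th coordinate. -/
theorem SymmCond.comp_reflectZero {n : ℕ} {F : (Fin (n + 1) → ℝ) → ℝ} (hsym : SymmCond F)
    (hhom : ∀ (c : ℝ) (v : Fin (n + 1) → ℝ), 0 < c → F (c • v) = c * F v) :
    F ∘ reflectZero n = F := by
  have key : ∀ v : Fin (n + 1) → ℝ, 0 < v 0 → F (reflectZero n v) = F v := by
    intro v hv
    set q : Fin (n + 1) → ℝ := (v 0)⁻¹ • v - Pi.single 0 1 with hq
    have hq0 : q 0 = 0 := by simp [hq, hv.ne']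
    have h1 : v = v 0 • (q + Pi.single 0 1) := by
      rw [hq, sub_add_cancel, smul_inv_smul₀ hv.ne']
    have h2 : reflectZero n v = v 0 • (q - Pi.single 0 1) := by
      conv_lhs => rw [h1]
      rw [map_smul, map_add, reflectZero_of_apply_zero hq0, reflectZero_single_zero,
        sub_eq_add_neg]
    rw [h2, hhom _ _ hv, ← hsym q hq0, ← hhom _ _ hv, ← h1]
  funext v
  rcases lt_trichotomy (v 0) 0 with hv | hv | hv
  · have h := key (reflectZero n v) (by simpa [reflectZero_apply] using hv)
    rw [reflectZero_reflectZero] at h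
    exact h.symm
  · simp [reflectZero_of_apply_zero hv]
  · exact key v hv

/-- The iterated derivatives of a function invariant under a linear equivalence are invariant
at the fixed points of that equivalence. -/
theorem iteratedFDeriv_apply_comp_of_invariant {E : Type*} [NormedAddCommGroup E]
    [NormedSpace ℝ E] {F : E → ℝ} {R : E ≃L[ℝ] E} (hF : F ∘ R = F) {p : E} (hp : R p = p)
    (k : ℕ) (v : Fin k → E) :
    iteratedFDeriv ℝ k F p (fun i => R (v i)) = iteratedFDeriv ℝ k F p v := by
  have h := R.iteratedFDerivWithin_comp_right F uniqueDiffOn_univ (x := p) (Set.mem_univ _) k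
  rw [Set.preimage_univ, iteratedFDerivWithin_univ, iteratedFDerivWithin_univ, hF, hp] at h
  conv_rhs => rw [h]
  rfl

/-- Consequences of the symmetry condition: vanishing of the
odd (in `φ⁰`) derivatives of `F` at points of `span{φ¹,…,φⁿ}`. -/
theorem symmetry_condition_implies
    {n : ℕ} (F : (Fin (n + 1) → ℝ) → ℝ)
    (hC3 : ContDiffOn ℝ 3 F {(0 : Fin (n + 1) → ℝ)}ᶜ)
    (hhom : ∀ (c : ℝ) (v : Fin (n + 1) → ℝ), 0 < c → F (c • v) = c * F v)
    (hsym : SymmCond F) :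
    ∀ p : Fin (n + 1) → ℝ, p ≠ 0 → p 0 = 0 →
      D1 F p (Pi.single 0 1) = 0 ∧
      (∀ j : Fin n, D2 F p (Pi.single 0 1) (Pi.single j.succ 1) = 0) ∧
      (∀ j k : Fin n,
        D3 F p (Pi.single 0 1) (Pi.single j.succ 1) (Pi.single k.succ 1) = 0) ∧
      D3 F p (Pi.single 0 1) (Pi.single 0 1) (Pi.single 0 1) = 0 := by
  intro p _ hp0
  have hp := reflectZero_of_apply_zero hp0
  have hinv := iteratedFDeriv_apply_comp_of_invariant (hsym.comp_reflectZero hhom) hp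
  have h0 := reflectZero_single_zero n
  refine ⟨?_, fun j => ?_, fun j k => ?_, ?_⟩
  · have h := hinv 1 ![Pi.single 0 1]
    simp only [iteratedFDeriv_one_apply, Matrix.cons_val_zero, h0, map_neg] at h
    unfold D1
    linarith
  · have h := hinv 2 ![Pi.single 0 1, Pi.single j.succ 1]
    have e : (fun i => reflectZero n (![Pi.single 0 1, Pi.single j.succ 1] i)) =
        ![(-1 : ℝ) • Pi.single 0 1, Pi.single j.succ 1] := by
      funext i
      fin_cases i <;> simp [h0, reflectZero_single_succ]
    have e' := (iteratedFDeriv ℝ 2 F p).cons_smul ![Pi.single j.succ 1] (-1) (Pi.single 0 1)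
    rw [e] at h
    have h' := h.symm.trans e'
    exact self_eq_neg.mp (h'.trans (neg_one_smul ℝ _))
  · have h := hinv 3 ![Pi.single 0 1, Pi.single j.succ 1, Pi.single k.succ 1]
    have e : (fun i => reflectZero n
        (![Pi.single 0 1, Pi.single j.succ 1, Pi.single k.succ 1] i)) =
        ![(-1 : ℝ) • Pi.single 0 1, Pi.single j.succ 1, Pi.single k.succ 1] := by
      funext i
      fin_cases i <;> simp [h0, reflectZero_single_succ]
    have e' := (iteratedFDeriv ℝ 3 F p).cons_smul
      ![Pi.single j.succ 1, Pi.single k.succ 1] (-1) (Pi.single 0 1)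
    rw [e] at h
    have h' := h.symm.trans e'
    exact self_eq_neg.mp (h'.trans (neg_one_smul ℝ _))
  · have h := hinv 3 ![Pi.single 0 1, Pi.single 0 1, Pi.single 0 1]
    have e : (fun i => reflectZero n (![Pi.single 0 1, Pi.single 0 1, Pi.single 0 1] i)) =
        fun i => (-1 : ℝ) • (![Pi.single 0 1, Pi.single 0 1, Pi.single 0 1] :
          Fin 3 → Fin (n + 1) → ℝ) i := by
      funext i
      fin_cases i <;> simp [h0]
    have e' := (iteratedFDeriv ℝ 3 F p).map_smul_univ (fun _ => (-1 : ℝ))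
      ![Pi.single 0 1, Pi.single 0 1, Pi.single 0 1]
    rw [e, e', smul_eq_mul, Fin.prod_const] at h
    unfold D3
    linarith
end

section
/- Let n > 1 and let F be an anisotropic area integrand on ℝ^(n+1). Then there exist constants k' > 0 and k > 0, depending only on F, such that for every p in the span of {φ¹,…,φⁿ}: k' ≤ Σ_{i=1}^n F(p − φ⁰)·D²F|_{p−φ⁰}(φⁱ,φⁱ) ≤ k. -/
open Real Filter Set

theorem D2_eq_fderiv_fderiv {E : Type*} [NormedAddCommGroup E] [NormedSpace ℝ E]
    (F : E → ℝ) (ν v w : E) : D2 F ν v w = fderiv ℝ (fderiv ℝ F) ν v w := by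
  simp [D2, iteratedFDeriv_two_apply]

/-- The second derivative of a positively one-homogeneous function is homogeneous of
degree `-1`. -/
theorem smul_D2_smul {E : Type*} [NormedAddCommGroup E] [NormedSpace ℝ E] {F : E → ℝ} {c : ℝ}
    (hc : c ≠ 0) (h : ∀ v, F (c • v) = c * F v) (ν v w : E) :
    c * D2 F (c • ν) v w = D2 F ν v w := by
  have h1 : (fun x ↦ fderiv ℝ F (c • x)) = fderiv ℝ F := by
    funext x
    have h2 : (fun x ↦ F (c • x)) = c • F := funext h
    have h3 := fderiv_comp_smul (𝕜 := ℝ) (f := F) (x := x) c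
    rw [h2, fderiv_const_smul_field] at h3
    exact (smul_right_injective _ hc h3).symm
  have h4 := fderiv_comp_smul (𝕜 := ℝ) (f := fderiv ℝ F) (x := ν) c
  rw [h1] at h4
  simp [D2_eq_fderiv_fderiv, h4]

/-- A second derivative that is positive in non-radial directions is nonnegative in every
direction, as soon as there is a non-radial direction. -/
theorem D2_self_nonneg {E : Type*} [NormedAddCommGroup E] [NormedSpace ℝ E] {F : E → ℝ} {ν u : E}
    (h : ∀ w : E, (∀ c : ℝ, w ≠ c • ν) → 0 < D2 F ν w w) (hu : ∀ c : ℝ, u ≠ c • ν) (w : E) :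
    0 ≤ D2 F ν w w := by
  by_cases hw : ∀ c : ℝ, w ≠ c • ν
  · exact (h w hw).le
  push Not at hw
  obtain ⟨c, rfl⟩ := hw
  have hcont : Continuous fun t : ℝ ↦ D2 F ν (c • ν + t • u) (c • ν + t • u) := by
    simp only [D2_eq_fderiv_fderiv]
    fun_prop
  have hlim := (hcont.tendsto 0).mono_left (nhdsWithin_le_nhds (s := {0}ᶜ))
  rw [zero_smul, add_zero] at hlim
  refine ge_of_tendsto hlim ?_
  filter_upwards [self_mem_nhdsWithin] with t ht
  refine (h _ fun d hd ↦ hu (t⁻¹ * (d - c)) ?_).le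
  rw [mul_smul, sub_smul, ← hd, add_sub_cancel_left, inv_smul_smul₀ ht]

theorem continuousOn_D2 {E : Type*} [NormedAddCommGroup E] [NormedSpace ℝ E] {F : E → ℝ}
    {s : Set E} (hs : IsOpen s) (hF : ContDiffOn ℝ 2 F s) (v w : E) :
    ContinuousOn (fun ν ↦ D2 F ν v w) s := by
  have h1 : ContDiffOn ℝ 1 (fderiv ℝ F) s := hF.fderiv_of_isOpen hs (by norm_num)
  have h2 := h1.continuousOn_fderiv_of_isOpen hs le_rfl
  simp only [D2_eq_fderiv_fderiv]
  fun_prop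

/-- A real function that is invariant under positive scaling, and continuous and positive away
from the origin, lies between two positive constants away from the origin. -/
theorem exists_pos_bounds_of_homogeneous {E : Type*} [NormedAddCommGroup E] [NormedSpace ℝ E]
    [ProperSpace E] [Nontrivial E] {G : E → ℝ} (hcont : ContinuousOn G {0}ᶜ)
    (hpos : ∀ ν ≠ 0, 0 < G ν) (hG : ∀ c : ℝ, 0 < c → ∀ ν, G (c • ν) = G ν) :
    ∃ k' > 0, ∃ k > 0, ∀ ν ≠ 0, k' ≤ G ν ∧ G ν ≤ k := by
  have hne (x : E) (hx : x ∈ Metric.sphere (0 : E) 1) : x ≠ 0 :=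
    ne_zero_of_mem_unit_sphere ⟨x, hx⟩
  have hS : IsCompact (Metric.sphere (0 : E) 1) := isCompact_sphere 0 1
  have hSne : (Metric.sphere (0 : E) 1).Nonempty :=
    NormedSpace.sphere_nonempty.mpr zero_le_one
  have hcS : ContinuousOn G (Metric.sphere 0 1) := hcont.mono hne
  obtain ⟨a, ha, hmin⟩ := hS.exists_isMinOn hSne hcS
  obtain ⟨b, hb, hmax⟩ := hS.exists_isMaxOn hSne hcS
  refine ⟨G a, hpos a (hne a ha), G b, hpos b (hne b hb), fun ν hν ↦ ?_⟩
  have hmem : ‖ν‖⁻¹ • ν ∈ Metric.sphere (0 : E) 1 := by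
    simpa using norm_smul_inv_norm (𝕜 := ℝ) hν
  rw [← hG ‖ν‖⁻¹ (by positivity) ν]
  exact ⟨hmin hmem, hmax hmem⟩

/-- At most one coordinate vector is a multiple of a given vector. -/
theorem Pi.single_ne_smul_of_eq_smul {ι : Type*} [DecidableEq ι] {ν : ι → ℝ} {i j : ι}
    (hij : i ≠ j) {c : ℝ} (h : Pi.single i 1 = c • ν) (d : ℝ) :
    (Pi.single j 1 : ι → ℝ) ≠ d • ν := by
  intro h'
  have hi : 1 = c * ν i := by simpa using congrFun h i
  have hj : 0 = c * ν j := by simpa [hij.symm] using congrFun h j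
  have hj' : 1 = d * ν j := by simpa using congrFun h' j
  rcases mul_eq_zero.mp hj.symm with h0 | h0 <;> simp [h0] at hi hj'

/-- Two-sided positive bounds on the trace
`Σᵢ F(p−φ⁰)·D²F|_{p−φ⁰}(φⁱ,φⁱ)` for `p ∈ span{φ¹,…,φⁿ}`, when `n > 1`. -/
theorem trace_G_bounds
    {n : ℕ} (hn : 1 < n) (F : (Fin (n + 1) → ℝ) → ℝ) (hF : IsAreaIntegrand F) :
    ∃ k' > (0 : ℝ), ∃ k > (0 : ℝ),
      ∀ p : Fin (n + 1) → ℝ, p 0 = 0 →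
        k' ≤ (∑ i : Fin n,
            F (p - Pi.single 0 1) *
              D2 F (p - Pi.single 0 1) (Pi.single i.succ 1) (Pi.single i.succ 1)) ∧
        (∑ i : Fin n,
            F (p - Pi.single 0 1) *
              D2 F (p - Pi.single 0 1) (Pi.single i.succ 1) (Pi.single i.succ 1)) ≤ k := by
  obtain ⟨hpos, -, hC3, hhom, hconv⟩ := hF
  have hopen : IsOpen ({0}ᶜ : Set (Fin (n + 1) → ℝ)) := isOpen_compl_singleton
  obtain ⟨k', hk', k, hk, h⟩ := exists_pos_bounds_of_homogeneous
    (G := fun ν ↦ ∑ i : Fin n, F ν * D2 F ν (Pi.single i.succ 1) (Pi.single i.succ 1))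
    (continuousOn_finsetSum _ fun i _ ↦ hC3.continuousOn.mul
      (continuousOn_D2 hopen (hC3.of_le (by norm_num)) _ _))
    (fun ν hν ↦ by
      obtain ⟨i, hi⟩ : ∃ i : Fin n, ∀ c : ℝ, (Pi.single i.succ 1 : Fin (n + 1) → ℝ) ≠ c • ν := by
        by_contra! hcon
        obtain ⟨c, hc⟩ := hcon ⟨0, by lia⟩
        obtain ⟨d, hd⟩ := hcon ⟨1, hn⟩
        exact Pi.single_ne_smul_of_eq_smul (by simp) hc d hd
      exact Finset.sum_pos'
        (fun j _ ↦ mul_nonneg (hpos ν hν).le (D2_self_nonneg (fun w ↦ hconv ν w hν) hi _))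
        ⟨i, Finset.mem_univ i, mul_pos (hpos ν hν) (hconv ν _ hν hi)⟩)
    (fun c hc ν ↦ Finset.sum_congr rfl fun i _ ↦ by
      rw [hhom c ν hc, ← smul_D2_smul hc.ne' (fun v ↦ hhom c v hc) ν]
      ring)
  refine ⟨k', hk', k, hk, fun p hp ↦ h _ fun h0 ↦ ?_⟩
  simpa [hp] using congrFun h0 0
end
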